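/- arXiv:2209.12719 — 4 statements merged into one kernel-verified Lean document; each statement's English description precedes it below -/
import Mathlib

section
/- Under the hypotheses of Theorem 1, the determinant det(A_{k+i-1,j})_{1≤i,j≤m} has degree exactly m·d_l + m(m-1)S/2 + m - l, where d_l is the maximal degree among deg A_{k,1},...,deg A_{k,m} and l is the smallest index attaining it. -/
open Polynomial

/-- `s` is the smallest slot attaining the maximal degree `e`. -/
def Lead {K : Type*} [Field K] {m : ℕ} (B : Fin m → Polynomial K) (s : ℕ) (e : ℕ) : Prop :=
  (∀ j : Fin m, (j : ℕ) = s → (B j).degree = (e : WithBot ℕ)) ∧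
  (∀ j : Fin m, (B j).degree ≤ (e : WithBot ℕ)) ∧
  (∀ j : Fin m, (j : ℕ) < s → (B j).degree < (e : WithBot ℕ))

lemma aux_le {K : Type*} [Field K] {p q : Polynomial K} {a b c : ℕ}
    (hp : p.degree ≤ (a : WithBot ℕ)) (hq : q.degree ≤ (b : WithBot ℕ)) (hc : a + b = c) :
    (p * q).degree ≤ (c : WithBot ℕ) := by
  subst hc
  rw [degree_mul]; push_cast; exact add_le_add hp hq

lemma aux_lt {K : Type*} [Field K] {p q : Polynomial K} {a b c : ℕ}
    (hp : p.degree ≤ (a : WithBot ℕ)) (hq : q.degree < (b : WithBot ℕ)) (hc : a + b ≤ c) :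
    (p * q).degree < (c : WithBot ℕ) := by
  by_cases h : q = 0
  · subst h; simp
  by_cases h' : p = 0
  · subst h'; simp
  rw [degree_eq_natDegree h] at hq
  rw [degree_eq_natDegree h'] at hp
  rw [degree_mul, degree_eq_natDegree h, degree_eq_natDegree h']
  norm_cast at *
  omega

lemma aux_eq {K : Type*} [Field K] {p q : Polynomial K} {a b c : ℕ}
    (hp : p.degree = (a : WithBot ℕ)) (hq : q.degree = (b : WithBot ℕ)) (hc : a + b = c) :
    (p * q).degree = (c : WithBot ℕ) := by
  subst hc
  rw [degree_mul, hp, hq]; push_cast; rfl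

lemma aux_theta {K : Type*} [Field K] (p : Polynomial K) :
    (X * derivative p).degree ≤ p.degree := by
  rw [degree_le_iff_coeff_zero]
  intro n hn
  cases n with
  | zero => simp
  | succ n => rw [coeff_X_mul, coeff_derivative, coeff_eq_zero_of_degree_lt hn, zero_mul]

lemma aux_add_lt {K : Type*} [Field K] {p q : Polynomial K} {a : WithBot ℕ}
    (hp : p.degree < a) (hq : q.degree < a) : (p + q).degree < a :=
  lt_of_le_of_lt (degree_add_le p q) (max_lt hp hq)

lemma aux_add_le {K : Type*} [Field K] {p q : Polynomial K} {a : WithBot ℕ}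
    (hp : p.degree ≤ a) (hq : q.degree ≤ a) : (p + q).degree ≤ a :=
  (degree_add_le p q).trans (max_le hp hq)

lemma aux_succ {K : Type*} [Field K] {p : Polynomial K} {a : ℕ} :
    p.degree < ((a + 1 : ℕ) : WithBot ℕ) ↔ p.degree ≤ (a : WithBot ℕ) := by
  by_cases h : p = 0
  · subst h; simp
  rw [degree_eq_natDegree h]
  norm_cast
  omega

lemma lead_step {K : Type*} [Field K] {m : ℕ} (hm : 2 ≤ m)
    (N : Polynomial K) (P : Fin m → Polynomial K) (S : ℕ)
    (hN : N.degree = (S : WithBot ℕ))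
    (hPm : ∀ j : Fin m, (j : ℕ) + 1 = m → (P j).degree = ((S + 1 : ℕ) : WithBot ℕ))
    (hPj : ∀ j : Fin m, (j : ℕ) + 1 < m → (P j).degree ≤ (S : WithBot ℕ))
    (B C : Fin m → Polynomial K) (z : Fin m) (hz : (z : ℕ) = 0)
    (hrec : ∀ j : Fin m, ∀ h : (j : ℕ) + 1 < m,
      C j = P j * B z + N * (X * derivative (B j)) + N * B ⟨(j : ℕ) + 1, h⟩)
    (hrecm : ∀ j : Fin m, (j : ℕ) + 1 = m →
      C j = P j * B z + N * (X * derivative (B j)))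
    (s e : ℕ) (hs : s < m) (hB : Lead B s e) :
    (0 < s → Lead C (s - 1) (S + e)) ∧ (s = 0 → Lead C (m - 1) (S + e + 1)) := by
  obtain ⟨h1, h2, h3⟩ := hB
  have th : ∀ j, (N * (X * derivative (B j))).degree ≤ ((S + e : ℕ) : WithBot ℕ) := fun j =>
    aux_le hN.le ((aux_theta _).trans (h2 j)) rfl
  have le1 : ∀ j : Fin m, (j : ℕ) + 1 < m → (C j).degree ≤ ((S + e : ℕ) : WithBot ℕ) := by
    intro j hj
    rw [hrec j hj]
    exact aux_add_le (aux_add_le (aux_le (hPj j hj) (h2 z) rfl) (th j))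
      (aux_le hN.le (h2 _) rfl)
  constructor
  · intro hs0
    have hz3 := h3 z (by omega)
    refine ⟨?_, ?_, ?_⟩
    · intro j hj
      have hj' : (j : ℕ) + 1 < m := by omega
      have e3 : (N * B ⟨(j : ℕ) + 1, hj'⟩).degree = ((S + e : ℕ) : WithBot ℕ) :=
        aux_eq hN (h1 _ (by simp only; omega)) rfl
      rw [hrec j hj', degree_add_eq_right_of_degree_lt, e3]
      rw [e3]
      exact aux_add_lt (aux_lt (hPj j hj') hz3 le_rfl)
        (aux_lt hN.le ((aux_theta _).trans_lt (h3 j (by omega))) le_rfl)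
    · intro j
      by_cases hj : (j : ℕ) + 1 < m
      · exact le1 j hj
      · have hj' : (j : ℕ) + 1 = m := by omega
        rw [hrecm j hj']
        refine aux_add_le (aux_succ.1 ?_) (th j)
        exact aux_lt (hPm j hj').le hz3 (by omega)
    · intro j hj
      have hj' : (j : ℕ) + 1 < m := by omega
      rw [hrec j hj']
      refine aux_add_lt (aux_add_lt (aux_lt (hPj j hj') hz3 le_rfl)
        (aux_lt hN.le ((aux_theta _).trans_lt (h3 j (by omega))) le_rfl))
        (aux_lt hN.le (h3 _ (by simp only; omega)) le_rfl)
  · intro hs0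
    have key : ∀ j : Fin m, (j : ℕ) + 1 = m →
        (C j).degree = ((S + e + 1 : ℕ) : WithBot ℕ) := by
      intro j hj
      have e3 : (P j * B z).degree = ((S + e + 1 : ℕ) : WithBot ℕ) :=
        aux_eq (hPm j hj) (h1 z (by omega)) (by omega)
      rw [hrecm j hj, degree_add_eq_left_of_degree_lt, e3]
      rw [e3]
      exact aux_succ.2 (th j)
    refine ⟨fun j hj => key j (by omega), ?_, fun j hj => aux_succ.2 (le1 j (by omega))⟩
    intro j
    by_cases hj : (j : ℕ) + 1 < m
    · exact (aux_succ.2 (le1 j hj)).le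
    · exact (key j (by omega)).le

lemma det_degree {K : Type*} [Field K] {m : ℕ} (M : Matrix (Fin m) (Fin m) (Polynomial K))
    (σ : Equiv.Perm (Fin m)) (e : Fin m → ℕ) (h : ∀ i, Lead (M i) (σ i : ℕ) (e i)) :
    M.det.degree = ((∑ i, e i : ℕ) : WithBot ℕ) := by
  have smul_deg : ∀ (τ : Equiv.Perm (Fin m)) (p : Polynomial K),
      (Equiv.Perm.sign τ • p).degree = p.degree := by
    intro τ p
    rcases Int.units_eq_one_or (Equiv.Perm.sign τ) with h | h <;> rw [h] <;> simp [Units.smul_def]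
  have pσ : (∏ i, M i (σ i)).degree = ((∑ i, e i : ℕ) : WithBot ℕ) := by
    rw [degree_prod]
    push_cast
    exact Finset.sum_congr rfl fun i _ => (h i).1 (σ i) rfl
  have pτ : ∀ τ : Equiv.Perm (Fin m), τ ≠ σ →
      (∏ i, M i (τ i)).degree < ((∑ i, e i : ℕ) : WithBot ℕ) := by
    intro τ hτ
    by_cases h0 : ∀ i, M i (τ i) ≠ 0
    · rw [degree_prod, Finset.sum_congr rfl fun i _ => degree_eq_natDegree (h0 i)]
      norm_cast
      have a1 : ∀ i, m * (M i (τ i)).natDegree + (σ i : ℕ) ≤ m * e i + (τ i : ℕ) ∧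
          (τ i ≠ σ i → m * (M i (τ i)).natDegree + (σ i : ℕ) < m * e i + (τ i : ℕ)) := by
        intro i
        obtain ⟨h1, h2, h3⟩ := h i
        have h2 := h2 (τ i)
        have h3 := h3 (τ i)
        rw [degree_eq_natDegree (h0 i)] at h2 h3
        norm_cast at h2 h3
        have b1 := (σ i).isLt
        have b2 := Nat.mul_le_mul_left m h2
        by_cases hlt : τ i < σ i
        · have b3 := Nat.mul_le_mul_left m (h3 hlt)
          rw [Nat.mul_succ] at b3
          constructor
          · omega
          · intro _; omega
        · have : (σ i : ℕ) ≤ τ i := by simpa using hlt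
          refine ⟨by omega, fun hne => ?_⟩
          have : (τ i : ℕ) ≠ σ i := fun hh => hne (Fin.ext hh)
          omega
      have hex : ∃ i, τ i ≠ σ i := by
        by_contra hcon
        push Not at hcon
        exact hτ (Equiv.ext hcon)
      obtain ⟨i0, hi0⟩ := hex
      have sl := Finset.sum_lt_sum (s := Finset.univ) (fun i _ => (a1 i).1)
        ⟨i0, Finset.mem_univ _, (a1 i0).2 hi0⟩
      rw [Finset.sum_add_distrib, Finset.sum_add_distrib, ← Finset.mul_sum, ← Finset.mul_sum,
        Equiv.sum_comp σ (fun j : Fin m => (j : ℕ)),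
        Equiv.sum_comp τ (fun j : Fin m => (j : ℕ))] at sl
      exact lt_of_mul_lt_mul_left (Nat.lt_of_add_lt_add_right sl) (Nat.zero_le m)
    · push Not at h0
      obtain ⟨i, hi⟩ := h0
      rw [Finset.prod_eq_zero (Finset.mem_univ i) hi, degree_zero]
      exact WithBot.bot_lt_coe _
  rw [← Matrix.det_transpose, Matrix.det_apply,
    ← Finset.add_sum_erase _ _ (Finset.mem_univ σ)]
  simp only [Matrix.transpose_apply]
  rw [degree_add_eq_left_of_degree_lt, smul_deg, pσ]
  rw [smul_deg, pσ, ← mem_degreeLT]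
  refine Submodule.sum_mem _ fun τ hτ => ?_
  rw [mem_degreeLT, smul_deg]
  exact pτ τ (Finset.ne_of_mem_erase hτ)

/-- **Formula (260).** Under the hypotheses of Theorem 1, the determinant
`det (A_{k+i-1,j})_{1≤i,j≤m}` has degree exactly `m·d_l + m(m-1)S/2 + m - l`, where
`d_l` is the maximal degree among `deg A_{k,1}, …, deg A_{k,m}` and `l` is the smallest
(1-indexed) index attaining it. (`A n j` with `j : Fin m` stands for `A_{n,j+1}`.) -/
theorem stmt6 (K : Type*) [Field K] [CharZero K]
    (m : ℕ) (hm : 2 ≤ m)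
    (N : Polynomial K) (P : Fin m → Polynomial K)
    (hN : N ≠ 0)
    (hPm : (P ⟨m - 1, by omega⟩).degree = N.degree + 1)
    (hPj : ∀ j : Fin m, (j : ℕ) + 1 < m → (P j).degree < N.degree + 1)
    (A : ℕ → Fin m → Polynomial K)
    (hA0 : ∃ j : Fin m, A 0 j ≠ 0)
    (hrec : ∀ k : ℕ, ∀ j : Fin m, ∀ h : (j : ℕ) + 1 < m,
      A (k + 1) j = P j * A k ⟨0, by omega⟩
        + N * (X * derivative (A k j)) + N * A k ⟨(j : ℕ) + 1, h⟩)
    (hrecm : ∀ k : ℕ,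
      A (k + 1) ⟨m - 1, by omega⟩ = P ⟨m - 1, by omega⟩ * A k ⟨0, by omega⟩
        + N * (X * derivative (A k ⟨m - 1, by omega⟩)))
    (k : ℕ) (l : ℕ) (hl1 : 1 ≤ l) (hlm : l ≤ m)
    -- d_l is finite, maximal among d₁,…,d_m, and l is the smallest index attaining it
    (hdl : A k ⟨l - 1, by omega⟩ ≠ 0)
    (hmax : ∀ j : Fin m, (A k j).degree ≤ (A k ⟨l - 1, by omega⟩).degree)
    (hfirst : ∀ j : Fin m, (j : ℕ) < l - 1 →
      (A k j).degree < (A k ⟨l - 1, by omega⟩).degree) :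
    (Matrix.det (Matrix.of fun i j : Fin m => A (k + (i : ℕ)) j)).degree =
      ((m * (A k ⟨l - 1, by omega⟩).natDegree + (m * (m - 1) / 2) * N.natDegree
        + (m - l) : ℕ) : WithBot ℕ) := by
  have hNd : N.degree = (N.natDegree : WithBot ℕ) := degree_eq_natDegree hN
  set S := N.natDegree with hS
  set d := (A k ⟨l - 1, by omega⟩).natDegree with hd
  have hdd : (A k ⟨l - 1, by omega⟩).degree = (d : WithBot ℕ) := degree_eq_natDegree hdl
  have lastEq : ∀ j : Fin m, (j : ℕ) + 1 = m → j = ⟨m - 1, by omega⟩ :=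
    fun j hj => Fin.ext (by simp only; omega)
  have step : ∀ n s e, s < m → Lead (A n) s e →
      (0 < s → Lead (A (n + 1)) (s - 1) (S + e)) ∧
      (s = 0 → Lead (A (n + 1)) (m - 1) (S + e + 1)) := by
    intro n s e hs hL
    refine lead_step hm N P S hNd ?_ ?_ (A n) (A (n + 1)) ⟨0, by omega⟩ rfl (hrec n) ?_ s e hs hL
    · intro j hj
      rw [lastEq j hj, hPm, hNd]; push_cast; rfl
    · intro j hj
      apply aux_succ.1
      have := hPj j hj
      rw [hNd] at this
      exact_mod_cast this
    · intro j hj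
      rw [lastEq j hj]; exact hrecm n
  have main : ∀ i, i < m → Lead (A (k + i)) (if i ≤ l - 1 then l - 1 - i else m + (l - 1) - i)
      (d + i * S + (if i ≤ l - 1 then 0 else 1)) := by
    intro i
    induction i with
    | zero =>
      intro _
      simp only [Nat.zero_le, if_true, Nat.sub_zero, Nat.zero_mul, Nat.add_zero]
      refine ⟨?_, ?_, ?_⟩
      · intro j hj
        have : j = ⟨l - 1, by omega⟩ := Fin.ext hj
        rw [this, hdd]
      · intro j
        rw [← hdd]; exact hmax j
      · intro j hj
        rw [← hdd]; exact hfirst j hj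
    | succ i ih =>
      intro hi
      have := step _ _ _ (by split_ifs <;> omega) (ih (by omega))
      rw [← Nat.add_assoc]
      by_cases c1 : i + 1 ≤ l - 1
      · rw [if_pos (by omega : i ≤ l - 1), if_pos (by omega : i ≤ l - 1)] at this
        rw [if_pos c1, if_pos c1]
        convert this.1 (by omega) using 1
        · omega
        · ring
      · rw [if_neg c1, if_neg c1]
        by_cases c2 : i ≤ l - 1
        · rw [if_pos c2, if_pos c2] at this
          convert this.2 (by omega) using 1
          · omega
          · ring
        · rw [if_neg c2, if_neg c2] at this
          convert this.1 (by omega) using 1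
          · omega
          · ring
  let f : Fin m → Fin m := fun i =>
    ⟨if (i : ℕ) ≤ l - 1 then l - 1 - i else m + (l - 1) - i, by
      have := i.isLt
      split_ifs <;> omega⟩
  have finj : Function.Injective f := by
    intro a b hab
    have h := congrArg Fin.val hab
    simp only [f] at h
    have := a.isLt
    have := b.isLt
    apply Fin.ext
    split_ifs at h <;> omega
  have hdet := det_degree (Matrix.of fun i j : Fin m => A (k + (i : ℕ)) j)
    (Equiv.ofBijective f (Finite.injective_iff_bijective.1 finj))
    (fun i => d + (i : ℕ) * S + (if (i : ℕ) ≤ l - 1 then 0 else 1))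
    (fun i => main i i.isLt)
  rw [hdet]
  congr 1
  rw [Fin.sum_univ_eq_sum_range (fun i => d + i * S + (if i ≤ l - 1 then 0 else 1)) m,
    Finset.sum_add_distrib, Finset.sum_add_distrib, ← Finset.sum_mul, Finset.sum_range_id]
  have cnt : ∀ n, (∑ i ∈ Finset.range n, if i ≤ l - 1 then 0 else 1) = n - l := by
    intro n
    induction n with
    | zero => simp
    | succ n ih =>
      rw [Finset.sum_range_succ, ih]
      split_ifs <;> omega
  rw [cnt]
  simp
end

section
/- Let m ≥ 2, T, Q_1,...,Q_m ∈ K[t] with r'_m = deg Q_m ≥ 0, deg T = r'_m + 1, and deg Q_j ≤ r'_m for all j = 1,...,m. Define B_{n,j} by nonzero initial data and the recurrences B_{k+1,j} = Q_j B_{k,1} + T·D B_{k,j} + T·B_{k,j+1} (j < m), B_{k+1,m} = Q_m B_{k,1} + T·D B_{k,m}. Then det(B_{k+i-1,j})_{1≤i,j≤m} ≠ 0 for all k ∈ ℕ. -/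
open Polynomial

/-- `g` has no coefficients in degrees `d` with `m * d > c`. -/
def Bd8 {K : Type*} [Field K] (m : ℕ) (g : Polynomial K) (c : ℤ) : Prop :=
  ∀ d : ℕ, c < (m : ℤ) * d → g.coeff d = 0

lemma Bd8.mono {K : Type*} [Field K] {m : ℕ} {g : Polynomial K} {c c' : ℤ}
    (h : Bd8 m g c) (hc : c ≤ c') : Bd8 m g c' := fun d hd => h d (by linarith)

lemma Bd8.add {K : Type*} [Field K] {m : ℕ} {f g : Polynomial K} {c : ℤ}
    (hf : Bd8 m f c) (hg : Bd8 m g c) : Bd8 m (f + g) c := fun d hd => by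
  rw [coeff_add, hf d hd, hg d hd, add_zero]

lemma Bd8.mul {K : Type*} [Field K] {m : ℕ} {f g : Polynomial K} {c : ℤ} {a : ℕ}
    (hf : f.natDegree ≤ a) (hg : Bd8 m g c) : Bd8 m (f * g) (c + m * a) := fun d hd => by
  rw [coeff_mul]
  refine Finset.sum_eq_zero fun x hx => ?_
  rw [Finset.HasAntidiagonal.mem_antidiagonal] at hx
  by_cases h : a < x.1
  · rw [coeff_eq_zero_of_natDegree_lt (lt_of_le_of_lt hf h), zero_mul]
  · have h2 : (x.1 : ℤ) ≤ a := by omega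
    have h3 : (d : ℤ) = x.1 + x.2 := by omega
    have h4 : (m : ℤ) * x.1 ≤ m * a := mul_le_mul_of_nonneg_left h2 (by positivity)
    rw [hg x.2 (by rw [h3, mul_add] at hd; linarith), mul_zero]

lemma Bd8.deriv {K : Type*} [Field K] {m : ℕ} {g : Polynomial K} {c : ℤ}
    (hg : Bd8 m g c) : Bd8 m (derivative g) (c - m) := fun d hd => by
  rw [coeff_derivative, hg (d + 1) (by push_cast; linarith), zero_mul]

lemma Bd8.natDegree_le {K : Type*} [Field K] {m : ℕ} (hm : 0 < m) {g : Polynomial K} {c : ℤ}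
    (hg : Bd8 m g c) (d : ℕ) (hc : c ≤ m * d) : g.natDegree ≤ d := by
  rw [natDegree_le_iff_coeff_eq_zero]
  intro e he
  apply hg
  have h1 : (d : ℤ) < e := by omega
  have h2 : (0 : ℤ) < m := by omega
  have := mul_lt_mul_of_pos_left h1 h2
  linarith

/-- weight exactly `N` -/
def Wt8 {K : Type*} [Field K] (m : ℕ) (v : Fin m → Polynomial K) (N : ℤ) : Prop :=
  (∀ j : Fin m, Bd8 m (v j) (N - (j : ℕ))) ∧
    ∃ (a : Fin m) (d : ℕ), N = m * d + (a : ℕ) ∧ (v a).coeff d ≠ 0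

lemma exists_Wt8 {K : Type*} [Field K] (m : ℕ) (v : Fin m → Polynomial K)
    (h : ∃ j, v j ≠ 0) : ∃ N, Wt8 m v N := by
  classical
  obtain ⟨a, ha, hmax⟩ := Finset.exists_max_image (Finset.univ.filter fun j => v j ≠ 0)
    (fun j => m * (v j).natDegree + (j : ℕ)) (by
      obtain ⟨j, hj⟩ := h
      exact ⟨j, by simp [hj]⟩)
  have ha' : v a ≠ 0 := by simpa using ha
  refine ⟨m * (v a).natDegree + (a : ℕ), fun j => ?_, a, _, rfl, by simpa using ha'⟩
  intro d hd
  by_cases hj : v j = 0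
  · simp [hj]
  have h1 := hmax j (by simp [hj])
  apply coeff_eq_zero_of_natDegree_lt
  by_contra hlt
  push Not at hlt
  have h2 := Nat.mul_le_mul_left m hlt
  zify at h1 h2
  linarith

lemma det_ne_zero_of_Wt8 {K : Type*} [Field K] (m : ℕ) (hm : 0 < m) (r : ℤ)
    (v : Fin m → Fin m → Polynomial K) (N : ℤ)
    (hv : ∀ i : Fin m, Wt8 m (v i) (N + (i : ℕ) * (m * r - 1))) :
    Matrix.det (Matrix.of fun i j : Fin m => v i j) ≠ 0 := by
  classical
  intro hdet
  obtain ⟨p, hp, hp0⟩ := Matrix.exists_vecMul_eq_zero_iff.mpr hdet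
  obtain ⟨i0, hi0⟩ := Function.ne_iff.mp hp
  obtain ⟨i, hi, hmax⟩ := Finset.exists_max_image (Finset.univ.filter fun j => p j ≠ 0)
    (fun i => (m : ℤ) * (p i).natDegree + (N + (i : ℕ) * (m * r - 1))) 
    ⟨i0, by simpa using hi0⟩
  have hi' : p i ≠ 0 := by simpa using hi
  obtain ⟨hb, a, d, hN, hc⟩ := hv i
  have hsum := congrArg (fun q => coeff q ((p i).natDegree + d)) (congrFun hp0 a)
  simp only [Matrix.vecMul, dotProduct, Matrix.of_apply, Pi.zero_apply, coeff_zero,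
    finsetSum_coeff] at hsum
  rw [Finset.sum_eq_single i] at hsum
  · rw [coeff_mul_add_eq_of_natDegree_le le_rfl
      ((hb a).natDegree_le hm d (by rw [hN]; linarith))] at hsum
    rcases mul_eq_zero.mp hsum with h | h
    · simp [hi'] at h
    · exact hc h
  · intro j _ hji
    by_cases hj : p j = 0
    · simp [hj]
    have h1 := hmax j (by simp [hj])
    have hne : (m : ℤ) * (p j).natDegree + (N + (j : ℕ) * (m * r - 1)) ≠
        (m : ℤ) * (p i).natDegree + (N + (i : ℕ) * (m * r - 1)) := by
      intro he
      apply hji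
      have hd : (m : ℤ) ∣ ((j : ℕ) : ℤ) - (i : ℕ) :=
        ⟨(p j).natDegree - (p i).natDegree + r * ((j : ℕ) - (i : ℕ)), by linarith⟩
      have h0 := Int.eq_zero_of_abs_lt_dvd hd (by rw [abs_lt]; omega)
      apply Fin.ext
      omega
    have h2 := lt_of_le_of_ne h1 hne
    apply Bd8.mul (le_refl (p j).natDegree) ((hv j).1 a)
    push_cast
    rw [mul_add]
    linarith
  · simp

lemma Wt8.step {K : Type*} [Field K] (m : ℕ) (hm : 2 ≤ m) (r : ℕ)
    (T : Polynomial K) (Q : Fin m → Polynomial K)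
    (hT : T.natDegree ≤ r + 1) (hT0 : T.coeff (r + 1) ≠ 0)
    (hQ : ∀ j, (Q j).natDegree ≤ r) (hQ0 : (Q ⟨m - 1, by omega⟩).coeff r ≠ 0)
    (v w : Fin m → Polynomial K)
    (hrec : ∀ j : Fin m, ∀ h : (j : ℕ) + 1 < m,
      w j = Q j * v ⟨0, by omega⟩ + T * derivative (v j) + T * v ⟨(j : ℕ) + 1, h⟩)
    (hrecm : w ⟨m - 1, by omega⟩ = Q ⟨m - 1, by omega⟩ * v ⟨0, by omega⟩
        + T * derivative (v ⟨m - 1, by omega⟩))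
    (N : ℤ) (hv : Wt8 m v N) : Wt8 m w (N + (m * (r + 1 : ℤ) - 1)) := by
  obtain ⟨hb, a, d, hN, hc⟩ := hv
  have hQv : ∀ j, Bd8 m (Q j * v ⟨0, by omega⟩) (N + m * r) := fun j => by
    simpa using Bd8.mul (hQ j) (hb ⟨0, by omega⟩)
  have hTD : ∀ j : Fin m, Bd8 m (T * derivative (v j)) (N - (j : ℕ) + m * r) := fun j =>
    (Bd8.mul hT (hb j).deriv).mono (by push_cast; linarith)
  have hTv : ∀ j : Fin m, Bd8 m (T * v j) (N - (j : ℕ) + m * (r + 1)) := fun j =>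
    (Bd8.mul hT (hb j)).mono (by push_cast; linarith)
  have hm' : (2 : ℤ) ≤ m := by omega
  refine ⟨fun j => ?_, ?_⟩
  · have hj := j.2
    by_cases h : (j : ℕ) + 1 < m
    · rw [hrec j h]
      refine ((hQv j).mono ?_).add ((hTD j).mono ?_) |>.add ((hTv _).mono ?_)
      · have : ((j : ℕ) : ℤ) + 1 < m := by omega
        linarith
      · linarith
      · push_cast; linarith
    · have hjm : j = ⟨m - 1, Nat.sub_one_lt (by omega)⟩ := Fin.ext (by simp; omega)
      rw [hjm]
      rw [hrecm]
      have hcast : ((m - 1 : ℕ) : ℤ) = m - 1 := by omega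
      refine ((hQv _).mono ?_).add ((hTD _).mono ?_)
      · simp only [hcast]; linarith
      · linarith
  · obtain ⟨a, ha⟩ := a
    rcases a with _ | b
    · refine ⟨⟨m - 1, by omega⟩, r + d, ?_, ?_⟩
      · have hcast : ((m - 1 : ℕ) : ℤ) = m - 1 := by omega
        rw [hN, hcast]; push_cast; ring
      · have hcast : ((m - 1 : ℕ) : ℤ) = m - 1 := by omega
        rw [hrecm, coeff_add, hTD _ (r + d) (by rw [hN]; push_cast [hcast]; linarith), add_zero,
          coeff_mul_add_eq_of_natDegree_le (hQ _)
          ((hb _).natDegree_le (by omega) d (by rw [hN]; simp))]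
        · exact mul_ne_zero hQ0 hc
    · refine ⟨⟨b, by omega⟩, r + 1 + d, ?_, ?_⟩
      · rw [hN]; push_cast; ring
      · have hbm : (b : ℤ) + 1 < m := by omega
        rw [hrec ⟨b, by omega⟩ ha, coeff_add, coeff_add,
          hTD _ (r + 1 + d) (by rw [hN]; push_cast; linarith),
          hQv _ (r + 1 + d) (by rw [hN]; push_cast; linarith), add_zero, zero_add,
          coeff_mul_add_eq_of_natDegree_le hT
          ((hb _).natDegree_le (by omega) d (by rw [hN]; push_cast; linarith))]
        exact mul_ne_zero hT0 hc



/-- **Theorem 2, case (290).** Let `m ≥ 2`, `T, Q₁, …, Q_m ∈ K[t]` with `r'_m = deg Q_m ≥ 0`,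
`deg T = r'_m + 1` and `deg Q_j ≤ r'_m` for all `j = 1, …, m`. Define `B_{n,j}` by arbitrary
nonzero initial data and the recurrences `B_{k+1,j} = Q_j B_{k,1} + T·D B_{k,j} + T·B_{k,j+1}`
(`j < m`) and `B_{k+1,m} = Q_m B_{k,1} + T·D B_{k,m}`. Then
`det (B_{k+i-1,j})_{1≤i,j≤m} ≠ 0` for all `k`.
(`B n j` with `j : Fin m` stands for `B_{n,j+1}`.) -/
theorem stmt8 (K : Type*) [Field K] [CharZero K]
    (m : ℕ) (hm : 2 ≤ m)
    (T : Polynomial K) (Q : Fin m → Polynomial K)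
    (hQm0 : Q ⟨m - 1, by omega⟩ ≠ 0)  -- r'_m = deg Q_m ≥ 0
    (hT : T.degree = (Q ⟨m - 1, by omega⟩).degree + 1)
    (hQj : ∀ j : Fin m, (Q j).degree ≤ (Q ⟨m - 1, by omega⟩).degree)
    (B : ℕ → Fin m → Polynomial K)
    (hB0 : ∃ j : Fin m, B 0 j ≠ 0)
    (hrec : ∀ k : ℕ, ∀ j : Fin m, ∀ h : (j : ℕ) + 1 < m,
      B (k + 1) j = Q j * B k ⟨0, by omega⟩
        + T * derivative (B k j) + T * B k ⟨(j : ℕ) + 1, h⟩)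
    (hrecm : ∀ k : ℕ,
      B (k + 1) ⟨m - 1, by omega⟩ = Q ⟨m - 1, by omega⟩ * B k ⟨0, by omega⟩
        + T * derivative (B k ⟨m - 1, by omega⟩)) :
    ∀ k : ℕ, Matrix.det (Matrix.of fun i j : Fin m => B (k + (i : ℕ)) j) ≠ 0 := by
  have hTn : T.natDegree = (Q ⟨m - 1, by omega⟩).natDegree + 1 := by
    apply natDegree_eq_of_degree_eq_some
    rw [hT, degree_eq_natDegree hQm0]
    rfl
  have hT0 : T ≠ 0 := by
    rintro rfl
    simp at hTn
  obtain ⟨N, hN⟩ := exists_Wt8 m (B 0) hB0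
  have key : ∀ k : ℕ, Wt8 m (B k)
      (N + (k : ℤ) * (m * (((Q ⟨m - 1, by omega⟩).natDegree : ℤ) + 1) - 1)) := by
    intro k
    induction k with
    | zero => simpa using hN
    | succ k ih =>
      have := Wt8.step m hm (Q ⟨m - 1, by omega⟩).natDegree T Q hTn.le
        (by rw [← hTn]; simpa using hT0)
        (fun j => natDegree_le_natDegree (hQj j)) (by simpa using hQm0)
        (B k) (B (k + 1)) (hrec k) (hrecm k) _ ih
      convert this using 1
      push_cast
      ring
  intro k
  apply det_ne_zero_of_Wt8 m (by omega) (((Q ⟨m - 1, by omega⟩).natDegree : ℤ) + 1)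
    (fun i j => B (k + (i : ℕ)) j)
    (N + (k : ℤ) * (m * (((Q ⟨m - 1, by omega⟩).natDegree : ℤ) + 1) - 1))
  intro i
  convert key (k + i) using 1
  push_cast
  ring
end

section
/- Let E = N(t)Δ^m - P_1(t)Δ^{m-1} - ... - P_m(t) be a differential operator with N, P_j ∈ K[t], S = deg N ≥ 0, deg P_m = S + 1 and deg P_j < S + 1 for j = 1,...,m-1, where Δ = t·d/dt. Then E is irreducible in the ring K(t)[Δ] of differential operators: E cannot be written as a product E_1·E_2 of two operators in K(t)[Δ] each of order strictly smaller than m. -/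
open Polynomial


/-- Multiplication by a rational function `f ∈ K(t)`, as an additive endomorphism of `K((t))`.
(The differential-operator ring `K(t)[Δ]` acts faithfully on `K((t))`, so we realize its
elements as endomorphisms of `K((t))`.) -/
noncomputable def mulOp (K : Type*) [Field K] (f : RatFunc K) :
    AddMonoid.End (LaurentSeries K) :=
  AddMonoidHom.mulLeft (f : LaurentSeries K)

/-- Multiplication by a polynomial, as an additive endomorphism of `K((t))`. -/
noncomputable def polyMulOp (K : Type*) [Field K] (p : Polynomial K) :
    AddMonoid.End (LaurentSeries K) :=
  mulOp K (algebraMap (Polynomial K) (RatFunc K) p)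

/-- The Euler operator `Δ = t·d/dt` on `K((t))`: `Δ(Σ aₙ tⁿ) = Σ n aₙ tⁿ`. -/
noncomputable def eulerOp (K : Type*) [Field K] : AddMonoid.End (LaurentSeries K) :=
  AddMonoidHom.mk' (fun f =>
    ⟨fun n => (n : K) * f.coeff n,
      f.isPWO_support'.mono fun n hn => by
        simp only [Function.mem_support] at hn ⊢
        exact right_ne_zero_of_mul hn⟩)
    (fun f g => by ext n; simp [mul_add])

noncomputable def iotaRF (K : Type*) [Field K] : RatFunc K →+* LaurentSeries K :=
  letI := RatFunc.liftAlgebra K (LaurentSeries K)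
  algebraMap (RatFunc K) (LaurentSeries K)
theorem mulOp_iota  (K : Type*) [Field K] (f : RatFunc K) (g : LaurentSeries K) :
  mulOp K f g = iotaRF K f * g := rfl
theorem iotaRF_X (K : Type*) [Field K] : iotaRF K RatFunc.X = HahnSeries.single 1 1 := RatFunc.coe_X
theorem iotaRF_C (K : Type*) [Field K] (a : K) :
    iotaRF K (RatFunc.C a) = HahnSeries.C a := by
  let := RatFunc.liftAlgebra K (LaurentSeries K)
  have : iotaRF K (algebraMap K[X] (RatFunc K) (C a)) = algebraMap K[X] (LaurentSeries K) (C a) :=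
    (IsScalarTower.algebraMap_apply K[X] (RatFunc K) (LaurentSeries K) (C a)).symm
  rw [← RatFunc.algebraMap_C, this]
  simp

theorem eulerOp_coeff (K : Type*) [Field K] (f : LaurentSeries K) (n : ℤ) :
    (eulerOp K f).coeff n = (n : K) * f.coeff n := rfl

theorem eulerOp_mul (K : Type*) [Field K] (f g : LaurentSeries K) :
    eulerOp K (f * g) = eulerOp K f * g + f * eulerOp K g := by
  have hs : ∀ f : LaurentSeries K, (eulerOp K f).support ⊆ f.support := by
    intro f n hn
    simp only [HahnSeries.mem_support, eulerOp_coeff] at hn ⊢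
    exact right_ne_zero_of_mul hn
  ext n
  rw [eulerOp_coeff, HahnSeries.coeff_add, HahnSeries.coeff_mul,
    HahnSeries.coeff_mul_left' f.isPWO_support (hs f),
    HahnSeries.coeff_mul_right' g.isPWO_support (hs g), Finset.mul_sum, ← Finset.sum_add_distrib]
  refine Finset.sum_congr rfl fun ij hij => ?_
  rw [Finset.mem_antidiagonal] at hij
  rw [eulerOp_coeff, eulerOp_coeff, ← hij.2.2]
  push_cast
  ring

theorem eulerOp_C (K : Type*) [Field K] (a : K) :
    eulerOp K (iotaRF K (RatFunc.C a)) = 0 := by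
  ext n
  rw [eulerOp_coeff, iotaRF_C, HahnSeries.C_apply, HahnSeries.coeff_single]
  split_ifs with h <;> simp [h]

theorem eulerOp_X (K : Type*) [Field K] :
    eulerOp K (iotaRF K RatFunc.X) =
      iotaRF K RatFunc.X := by
  ext n
  rw [eulerOp_coeff, iotaRF_X, HahnSeries.coeff_single]
  split_ifs with h <;> simp [h]

theorem eulerOp_poly (K : Type*) [Field K] (p : K[X]) :
    eulerOp K (iotaRF K (algebraMap K[X] (RatFunc K) p)) =
      iotaRF K
        (algebraMap K[X] (RatFunc K) (X * derivative p)) := by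
  induction p using Polynomial.induction_on' with
  | add p q hp hq => simp only [map_add, hp, hq, mul_add]
  | monomial n a =>
    rw [← C_mul_X_pow_eq_monomial]
    induction n with
    | zero => simpa using eulerOp_C K a
    | succ n ih =>
      rw [pow_succ, ← mul_assoc, map_mul, map_mul, eulerOp_mul, ih, RatFunc.algebraMap_X,
        eulerOp_X]
      simp only [← map_mul, ← map_add, ← RatFunc.algebraMap_X]
      congr 2
      simp only [derivative_mul, derivative_X, derivative_C, derivative_X_pow]
      ring

open Classical in
theorem exists_theta (K : Type*) [Field K] (f : RatFunc K) : ∃ g : RatFunc K,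
    iotaRF K g =
      eulerOp K (iotaRF K f) ∧
    RatFunc.inftyValuation K g ≤ RatFunc.inftyValuation K f := by
  have hv : ∀ p : K[X], RatFunc.inftyValuation K (algebraMap K[X] (RatFunc K) (X * derivative p))
      ≤ RatFunc.inftyValuation K (algebraMap K[X] (RatFunc K) p) := by
    intro p
    by_cases h : derivative p = 0
    · simp [h]
    · have hp : p ≠ 0 := by rintro rfl; simp at h
      rw [RatFunc.inftyValuation_apply, RatFunc.inftyValuation_apply,
        RatFunc.inftyValuation.polynomial K (mul_ne_zero X_ne_zero h),
        RatFunc.inftyValuation.polynomial K hp, WithZero.exp_le_exp, natDegree_X_mul h]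
      have h1 : p.natDegree ≠ 0 := fun h0 => h (derivative_of_natDegree_zero h0)
      have := natDegree_derivative_lt h1
      omega
  obtain ⟨p, q, hq, rfl⟩ := IsFractionRing.div_surjective (A := K[X]) f
  have hq0 : q ≠ 0 := nonZeroDivisors.ne_zero hq
  have hq1 : algebraMap K[X] (RatFunc K) q ≠ 0 := by simpa using hq0
  set P := algebraMap K[X] (RatFunc K) p
  set Q := algebraMap K[X] (RatFunc K) q
  set P' := algebraMap K[X] (RatFunc K) (X * derivative p) with hP'
  set Q' := algebraMap K[X] (RatFunc K) (X * derivative q) with hQ'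
  have hQL : iotaRF K Q ≠ 0 := by
    simpa using hq1
  refine ⟨P' / Q - P / Q * (Q' / Q), ?_, ?_⟩
  · have h1 : eulerOp K (iotaRF K P) = 
      eulerOp K (iotaRF K (P / Q * Q)) := by
      rw [div_mul_cancel₀ _ hq1]
    rw [map_mul, eulerOp_mul, eulerOp_poly, eulerOp_poly, ← hP', ← hQ'] at h1
    apply mul_right_cancel₀ hQL
    rw [eq_sub_of_add_eq h1.symm, ← map_mul, ← map_mul, ← map_sub]
    congr 1
    field_simp
  · have hvQ : RatFunc.inftyValuation K Q ≠ 0 := (Valuation.ne_zero_iff _).2 hq1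
    refine (Valuation.map_sub _ _ _).trans (max_le ?_ ?_)
    · rw [map_div₀, map_div₀]
      gcongr
      · exact zero_le
      · exact hv p
    · rw [map_mul]
      refine mul_le_of_le_one_right' ?_
      rw [map_div₀]
      exact div_le_one_of_le₀ (hv q) zero_le


open scoped WithZero in
/-- Weight bound: every coefficient of `p` has weight `< w`. -/
def WLt {F : Type*} [Field F] (u : Valuation F ℤᵐ⁰) (p : F[X]) (w : ℤᵐ⁰) : Prop :=
  ∀ l : ℕ, u (p.coeff l) * WithZero.exp (l : ℤ) < w

/-- Coefficientwise application of an additive map. -/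
noncomputable def thetaP {F : Type*} [Field F] (θ : F →+ F) (p : F[X]) : F[X] :=
  ∑ l ∈ Finset.range (p.natDegree + 1), monomial l (θ (p.coeff l))

theorem thetaP_coeff {F : Type*} [Field F] (θ : F →+ F) (p : F[X]) (l : ℕ) :
    (thetaP θ p).coeff l = θ (p.coeff l) := by
  simp only [thetaP, finsetSum_coeff, coeff_monomial, Finset.sum_ite_eq', Finset.mem_range]
  split_ifs with h
  · rfl
  · rw [coeff_eq_zero_of_natDegree_lt (by omega), map_zero]

theorem thetaP_eval {F : Type*} [Field F] (θ : F →+ F) (p : F[X]) (n : ℕ) :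
    (thetaP θ p).eval (n : F) = θ (p.eval (n : F)) := by
  rw [eval_eq_sum_range (p := p), map_sum, thetaP, eval_finsetSum]
  refine Finset.sum_congr rfl fun l _ => ?_
  rw [eval_monomial, ← Nat.cast_pow, mul_comm, ← nsmul_eq_mul, mul_comm (p.coeff l),
    ← nsmul_eq_mul, map_nsmul]

/-- The symbol of `Δ` acting on `c(n) t^n`. -/
noncomputable def dP {F : Type*} [Field F] (θ : F →+ F) (p : F[X]) : F[X] := X * p + thetaP θ p

open scoped WithZero

theorem WLt.add {F : Type*} [Field F] {u : Valuation F ℤᵐ⁰} {p q : F[X]} {w : ℤᵐ⁰}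
    (hp : WLt u p w) (hq : WLt u q w) : WLt u (p + q) w := by
  intro l
  rw [coeff_add]
  rcases le_total (u (p.coeff l)) (u (q.coeff l)) with h | h
  · exact (mul_le_mul_left ((u.map_add _ _).trans (max_le h le_rfl)) _).trans_lt (hq l)
  · exact (mul_le_mul_left ((u.map_add _ _).trans (max_le le_rfl h)) _).trans_lt (hp l)

theorem WLt.zero {F : Type*} [Field F] {u : Valuation F ℤᵐ⁰} {w : ℤᵐ⁰}
    (hw : w ≠ 0) : WLt u 0 w := by
  intro l
  simpa using WithZero.pos_iff_ne_zero.2 hw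

theorem WLt.sum {F : Type*} [Field F] {u : Valuation F ℤᵐ⁰} {w : ℤᵐ⁰}
    (hw : w ≠ 0) {ι : Type*} (s : Finset ι) (f : ι → F[X]) (h : ∀ i ∈ s, WLt u (f i) w) :
    WLt u (∑ i ∈ s, f i) w := by
  classical
  induction s using Finset.induction_on with
  | empty => simpa using WLt.zero hw
  | insert a s ha ih =>
    rw [Finset.sum_insert ha]
    exact (h a (by simp)).add (ih fun i hi => h i (by simp [hi]))

theorem WLt.monomial {F : Type*} [Field F] {u : Valuation F ℤᵐ⁰} {w : ℤᵐ⁰}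
    (hw : w ≠ 0) {k : ℕ} {a : F} (h : u a * WithZero.exp (k : ℤ) < w) :
    WLt u (monomial k a) w := by
  intro l
  rw [coeff_monomial]
  split_ifs with hl
  · rwa [← hl]
  · simpa using WithZero.pos_iff_ne_zero.2 hw

theorem WLt.C_mul {F : Type*} [Field F] {u : Valuation F ℤᵐ⁰} {w : ℤᵐ⁰} {p : F[X]}
    (hp : WLt u p w) {a : F} (ha : a ≠ 0) :
    WLt u (C a * p) (u a * w) := by
  intro l
  rw [coeff_C_mul, map_mul, mul_assoc]
  exact mul_lt_mul_of_pos_left (hp l) (WithZero.pos_iff_ne_zero.2 ((Valuation.ne_zero_iff _).2 ha))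

theorem WLt.mono {F : Type*} [Field F] {u : Valuation F ℤᵐ⁰} {w w' : ℤᵐ⁰} {p : F[X]}
    (hp : WLt u p w) (h : w ≤ w') : WLt u p w' := fun l => (hp l).trans_le h

theorem WLt.thetaP {F : Type*} [Field F] {u : Valuation F ℤᵐ⁰} {w : ℤᵐ⁰} {p : F[X]}
    (hp : WLt u p w) (θ : F →+ F) (hθ : ∀ f, u (θ f) ≤ u f) : WLt u (thetaP θ p) w := by
  intro l
  rw [thetaP_coeff]
  exact (mul_le_mul_left (hθ _) _).trans_lt (hp l)

theorem WLt.X_mul {F : Type*} [Field F] {u : Valuation F ℤᵐ⁰} {w : ℤᵐ⁰} {p : F[X]}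
    (hp : WLt u p w) : WLt u (X * p) (w * WithZero.exp (1 : ℤ)) := by
  intro l
  have hw : w ≠ 0 := (pos_of_gt (hp 0)).ne'
  cases l with
  | zero => simpa using WithZero.pos_iff_ne_zero.2 hw
  | succ l =>
    rw [coeff_X_mul]
    push_cast
    rw [WithZero.exp_add, ← mul_assoc]
    exact mul_lt_mul_of_pos_right (hp l) WithZero.exp_pos

theorem lt_mul_exp_one {w : ℤᵐ⁰} (hw : w ≠ 0) : w < w * WithZero.exp (1 : ℤ) := by
  refine lt_mul_of_one_lt_right (WithZero.pos_iff_ne_zero.2 hw) ?_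
  rw [← WithZero.exp_zero, WithZero.exp_lt_exp]
  norm_num

theorem thetaP_add {F : Type*} [Field F] (θ : F →+ F) (p q : F[X]) :
    thetaP θ (p + q) = thetaP θ p + thetaP θ q := by
  ext l; simp [thetaP_coeff]

theorem thetaP_monomial {F : Type*} [Field F] (θ : F →+ F) (k : ℕ) (a : F) :
    thetaP θ (monomial k a) = monomial k (θ a) := by
  ext l
  rw [thetaP_coeff, coeff_monomial, coeff_monomial]
  split_ifs <;> simp

theorem dP_iterate {F : Type*} [Field F] {u : Valuation F ℤᵐ⁰} (θ : F →+ F)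
    (hθ : ∀ f, u (θ f) ≤ u f) {k : ℕ} {a : F} {R : F[X]} {w : ℤᵐ⁰} (hw : w ≠ 0)
    (ha : u a * WithZero.exp (k : ℤ) = w) (hR : WLt u R w) (i : ℕ) :
    ∃ R' : F[X], (dP θ)^[i] (monomial k a + R) = monomial (k + i) a + R' ∧
      WLt u R' (w * WithZero.exp (i : ℤ)) := by
  induction i with
  | zero => exact ⟨R, rfl, by simpa using hR⟩
  | succ i ih =>
    obtain ⟨R', h1, h2⟩ := ih
    have hw' : w * WithZero.exp (i : ℤ) ≠ 0 := mul_ne_zero hw WithZero.exp_ne_zero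
    have he : w * WithZero.exp ((i + 1 : ℕ) : ℤ) =
        w * WithZero.exp (i : ℤ) * WithZero.exp (1 : ℤ) := by
      push_cast
      rw [WithZero.exp_add, mul_assoc]
    refine ⟨monomial (k + i) (θ a) + (X * R' + thetaP θ R'), ?_, ?_⟩
    · rw [Function.iterate_succ_apply', h1, dP, thetaP_add, thetaP_monomial, mul_add,
        X_mul_monomial]
      rw [← add_assoc k i 1]
      abel
    · rw [he]
      have hlt := lt_mul_exp_one hw'
      refine (WLt.monomial (hw'.bot_lt.trans hlt).ne' ?_).add
        (h2.X_mul.add ((h2.thetaP θ hθ).mono hlt.le))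
      refine lt_of_le_of_lt ?_ hlt
      rw [← ha]
      push_cast
      rw [WithZero.exp_add, ← mul_assoc]
      exact mul_le_mul_left (mul_le_mul_left (hθ a) _) _

/-- Among the weights of an operator of order `< m`, there is a unique maximal one. -/
theorem exists_lead {F : Type*} [Field F] {u : Valuation F ℤᵐ⁰} {m : ℕ}
    (hu : ∀ f : F, f ≠ 0 → ∃ d : ℤ, u f = WithZero.exp (m * d))
    (b : Fin m → F) (hb : ∃ i, b i ≠ 0) :
    ∃ i₀, b i₀ ≠ 0 ∧ ∀ i, i ≠ i₀ → u (b i) * WithZero.exp ((i : ℕ) : ℤ) <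
      u (b i₀) * WithZero.exp ((i₀ : ℕ) : ℤ) := by
  obtain ⟨i₁, hi₁⟩ := hb
  have : Nonempty (Fin m) := ⟨i₁⟩
  obtain ⟨i₀, h₀⟩ := Finite.exists_max (fun i => u (b i) * WithZero.exp ((i : ℕ) : ℤ))
  have hb0 : b i₀ ≠ 0 := by
    intro h
    have := h₀ i₁
    simp only [h, map_zero, zero_mul, le_zero_iff, mul_eq_zero, WithZero.exp_ne_zero, or_false,
      map_eq_zero] at this
    exact hi₁ this
  refine ⟨i₀, hb0, fun i hi => lt_of_le_of_ne (h₀ i) fun heq => hi ?_⟩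
  have hbi : b i ≠ 0 := by
    intro h
    rw [h, map_zero, zero_mul] at heq
    exact (mul_ne_zero ((Valuation.ne_zero_iff _).2 hb0) WithZero.exp_ne_zero) heq.symm
  obtain ⟨d, hd⟩ := hu _ hbi
  obtain ⟨d', hd'⟩ := hu _ hb0
  rw [hd, hd', ← WithZero.exp_add, ← WithZero.exp_add, WithZero.exp_inj] at heq
  have h1 : (((i : ℕ) : ℤ)) % m = ((i₀ : ℕ) : ℤ) % m := by
    have := congrArg (· % (m : ℤ)) heq
    simpa [Int.add_emod] using this
  rw [Int.emod_eq_of_lt (by positivity) (by exact_mod_cast i.2),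
    Int.emod_eq_of_lt (by positivity) (by exact_mod_cast i₀.2)] at h1
  exact Fin.ext (by exact_mod_cast h1)

theorem core {F : Type*} [Field F] {u : Valuation F ℤᵐ⁰} {m : ℕ} (θ : F →+ F)
    (hθ : ∀ f, u (θ f) ≤ u f)
    (hu : ∀ f : F, f ≠ 0 → ∃ d : ℤ, u f = WithZero.exp (m * d))
    (b c : Fin m → F) (hb : ∃ i, b i ≠ 0) (hc : ∃ i, c i ≠ 0) (E : F[X])
    (hE : E = ∑ i : Fin m, C (b i) * (dP θ)^[i] (∑ j : Fin m, monomial (j : ℕ) (c j))) :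
    ∃ (k : ℕ) (W : ℤᵐ⁰), u (E.coeff k) * WithZero.exp (k : ℤ) = W ∧
      ∀ l : ℕ, l ≠ k → u (E.coeff l) * WithZero.exp (l : ℤ) < W := by
  classical
  obtain ⟨i₀, hb0, hbi⟩ := exists_lead hu b hb
  obtain ⟨j₀, hc0, hcj⟩ := exists_lead hu c hc
  set wb := u (b i₀) * WithZero.exp ((i₀ : ℕ) : ℤ) with hwb
  set wc := u (c j₀) * WithZero.exp ((j₀ : ℕ) : ℤ) with hwc
  have hwb0 : wb ≠ 0 := mul_ne_zero ((Valuation.ne_zero_iff _).2 hb0) WithZero.exp_ne_zero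
  have hwc0 : wc ≠ 0 := mul_ne_zero ((Valuation.ne_zero_iff _).2 hc0) WithZero.exp_ne_zero
  have hW0 : wb * wc ≠ 0 := mul_ne_zero hwb0 hwc0
  have hCR : WLt u (∑ j ∈ Finset.univ.erase j₀, monomial (j : ℕ) (c j)) wc :=
    WLt.sum hwc0 _ _ fun j hj => WLt.monomial hwc0 (hcj j (Finset.ne_of_mem_erase hj))
  rw [← Finset.add_sum_erase Finset.univ (fun j : Fin m => monomial (j : ℕ) (c j))
    (Finset.mem_univ j₀)] at hE
  choose R hR1 hR2 using fun i : ℕ => dP_iterate θ hθ hwc0 hwc.symm hCR i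
  have hterm : ∀ i : Fin m, C (b i) * (monomial ((j₀ : ℕ) + i) (c j₀) + R i) =
      monomial ((j₀ : ℕ) + i) (b i * c j₀) + C (b i) * R i := by
    intro i
    rw [mul_add, C_mul_monomial]
  have hsmall : ∀ i : Fin m, WLt u (C (b i) * R i) (wb * wc) := by
    intro i
    by_cases h : b i = 0
    · simpa [h] using WLt.zero hW0
    · refine ((hR2 i).C_mul h).mono ?_
      rw [mul_comm wc, ← mul_assoc]
      refine mul_le_mul_left ?_ _
      by_cases hi : i = i₀
      · rw [hi]
      · exact (hbi i hi).le
  have hmon : ∀ i : Fin m, u (b i * c j₀) * WithZero.exp ((((j₀ : ℕ) + i : ℕ)) : ℤ) =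
      u (b i) * WithZero.exp ((i : ℕ) : ℤ) * wc := by
    intro i
    push_cast
    rw [map_mul, WithZero.exp_add, hwc]
    ac_rfl
  have hE2 : E = monomial ((j₀ : ℕ) + i₀) (b i₀ * c j₀) + (C (b i₀) * R i₀ +
      ∑ i ∈ Finset.univ.erase i₀, (monomial ((j₀ : ℕ) + i) (b i * c j₀) + C (b i) * R i)) := by
    rw [hE, ← add_assoc, ← hterm i₀, ← Finset.add_sum_erase _ _ (Finset.mem_univ i₀), hR1]
    congr 1
    exact Finset.sum_congr rfl fun i _ => by rw [hR1, hterm]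
  have hrest : WLt u (C (b i₀) * R i₀ +
      ∑ i ∈ Finset.univ.erase i₀, (monomial ((j₀ : ℕ) + i) (b i * c j₀) + C (b i) * R i))
      (wb * wc) := by
    refine (hsmall i₀).add (WLt.sum hW0 _ _ fun i hi => WLt.add (WLt.monomial hW0 ?_) (hsmall i))
    rw [hmon]
    exact mul_lt_mul_of_pos_right (hbi i (Finset.ne_of_mem_erase hi))
      (WithZero.pos_iff_ne_zero.2 hwc0)
  generalize (C (b i₀) * R i₀ +
      ∑ i ∈ Finset.univ.erase i₀, (monomial ((j₀ : ℕ) + i) (b i * c j₀) + C (b i) * R i)) = T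
    at hE2 hrest
  refine ⟨(j₀ : ℕ) + i₀, wb * wc, ?_, fun l hl => ?_⟩
  · have h1 := hrest ((j₀ : ℕ) + i₀)
    rw [hwb, ← hmon i₀] at h1 ⊢
    rw [hE2, coeff_add, coeff_monomial, if_pos rfl, Valuation.map_add_eq_of_lt_left]
    exact lt_of_mul_lt_mul_right h1 zero_le
  · rw [hE2, coeff_add, coeff_monomial, if_neg (Ne.symm hl), zero_add]
    exact hrest l


theorem endo_mul_apply {A : Type*} [AddCommGroup A] (f g : AddMonoid.End A) (x : A) :
    (f * g) x = f (g x) := rfl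

theorem endo_sub_apply {A : Type*} [AddCommGroup A] (f g : AddMonoid.End A) (x : A) :
    (f - g) x = f x - g x := rfl

theorem endo_sum_apply {A : Type*} [AddCommGroup A] {ι : Type*} (s : Finset ι)
    (f : ι → AddMonoid.End A) (x : A) : (∑ i ∈ s, f i) x = ∑ i ∈ s, f i x :=
  map_sum (AddMonoidHom.mk' (fun h : AddMonoid.End A => h x) fun _ _ => rfl) f s

theorem hom_facts (K : Type*) [Field K] : ∃ θ : RatFunc K →+ RatFunc K,
    (∀ f, iotaRF K (θ f) = eulerOp K (iotaRF K f)) ∧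
    (∀ (n i : ℕ) (p : (RatFunc K)[X]), θ^[i] (p.eval (n : RatFunc K) * RatFunc.X ^ n) =
      ((dP θ)^[i] p).eval (n : RatFunc K) * RatFunc.X ^ n) ∧
    (∀ (n i : ℕ), θ^[i] (RatFunc.X ^ n) = (n : RatFunc K) ^ i * RatFunc.X ^ n) ∧
    (open Classical in ∀ f, RatFunc.inftyValuation K (θ f) ≤ RatFunc.inftyValuation K f) := by
  classical
  have hinj : Function.Injective (iotaRF K) := RingHom.injective _
  choose t ht1 ht2 using exists_theta K
  let θ : RatFunc K →+ RatFunc K := AddMonoidHom.mk' t fun f g => hinj (by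
    rw [map_add, ht1, ht1, ht1, map_add, map_add])
  have hθ : ∀ f, iotaRF K (θ f) = eulerOp K (iotaRF K f) := ht1
  have hmul : ∀ f g, θ (f * g) = θ f * g + f * θ g := fun f g => hinj (by
    rw [hθ, map_mul, eulerOp_mul, map_add, map_mul, map_mul, hθ, hθ])
  have hX : θ RatFunc.X = RatFunc.X := hinj (by rw [hθ, eulerOp_X])
  have hone : θ 1 = 0 := by
    have := hmul 1 1
    simpa using this
  have hXn : ∀ n : ℕ, θ (RatFunc.X ^ n) = (n : RatFunc K) * RatFunc.X ^ n := by
    intro n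
    induction n with
    | zero => simpa using hone
    | succ n ih =>
      rw [pow_succ, hmul, ih, hX]
      push_cast
      ring
  have h2 : ∀ (n i : ℕ) (p : (RatFunc K)[X]), θ^[i] (p.eval (n : RatFunc K) * RatFunc.X ^ n) =
      ((dP θ)^[i] p).eval (n : RatFunc K) * RatFunc.X ^ n := by
    intro n i p
    induction i generalizing p with
    | zero => rfl
    | succ i ih =>
      rw [Function.iterate_succ_apply, Function.iterate_succ_apply, ← ih]
      congr 1
      rw [hmul, hXn, dP, eval_add, thetaP_eval, eval_mul, eval_X]
      ring
  refine ⟨θ, hθ, h2, ?_, ht2⟩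
  intro n i
  induction i with
  | zero => simp
  | succ i ih =>
    rw [Function.iterate_succ_apply', ih, ← Nat.cast_pow, ← nsmul_eq_mul, map_nsmul, hXn,
      nsmul_eq_mul]
    push_cast
    ring

theorem eulerOp_pow_iota (K : Type*) [Field K] (θ : RatFunc K →+ RatFunc K)
    (hθ : ∀ f, iotaRF K (θ f) = eulerOp K (iotaRF K f)) (i : ℕ) (f : RatFunc K) :
    (eulerOp K ^ i) (iotaRF K f) = iotaRF K (θ^[i] f) := by
  induction i generalizing f with
  | zero => rfl
  | succ i ih =>
    rw [pow_succ, endo_mul_apply, ← hθ, ih, Function.iterate_succ_apply]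

theorem op_iota (K : Type*) [Field K] (θ : RatFunc K →+ RatFunc K)
    (hθ : ∀ f, iotaRF K (θ f) = eulerOp K (iotaRF K f)) {m : ℕ} (b : Fin m → RatFunc K)
    (e : Fin m → ℕ) (f : RatFunc K) :
    (∑ i : Fin m, mulOp K (b i) * eulerOp K ^ (e i)) (iotaRF K f) =
      iotaRF K (∑ i : Fin m, b i * θ^[e i] f) := by
  rw [endo_sum_apply, map_sum]
  refine Finset.sum_congr rfl fun i _ => ?_
  rw [endo_mul_apply, eulerOp_pow_iota K θ hθ, mulOp_iota, map_mul]

/-- **Corollary 4.1.** Let `E = N(t)Δ^m - P₁(t)Δ^{m-1} - … - P_m(t)` with `N, P_j ∈ K[t]`,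
`S = deg N ≥ 0`, `deg P_m = S + 1` and `deg P_j < S + 1` for `j = 1, …, m-1`, where
`Δ = t·d/dt`. Then `E` is irreducible in the ring `K(t)[Δ]` of differential operators:
`E` cannot be written as a product `E₁·E₂` of two differential operators with coefficients
in `K(t)`, each of order strictly smaller than `m` (i.e. each of the form
`Σ_{i<m} cᵢ(t)·Δ^i`).  (`P j` stands for `P_{j+1}`, so `Δ^{m-1-j}` is `Δ^{m-(j+1)}`.) -/
theorem stmt9 (K : Type*) [Field K] [CharZero K]
    (m : ℕ) (hm : 2 ≤ m)
    (N : Polynomial K) (P : Fin m → Polynomial K)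
    (hN : N ≠ 0)
    (hPm : (P ⟨m - 1, by omega⟩).degree = N.degree + 1)
    (hPj : ∀ j : Fin m, (j : ℕ) + 1 < m → (P j).degree < N.degree + 1) :
    ¬ ∃ b c : Fin m → RatFunc K,
      polyMulOp K N * eulerOp K ^ m
          - ∑ j : Fin m, polyMulOp K (P j) * eulerOp K ^ (m - 1 - (j : ℕ)) =
        (∑ i : Fin m, mulOp K (b i) * eulerOp K ^ (i : ℕ)) *
        (∑ i : Fin m, mulOp K (c i) * eulerOp K ^ (i : ℕ)) := by
  classical
  rintro ⟨b, c, hbc⟩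
  have hinj : Function.Injective (iotaRF K) := RingHom.injective _
  obtain ⟨θ, hθ, hθev, hθX, hθv⟩ := hom_facts K
  have hm0 : m ≠ 0 := by omega
  let ν := RatFunc.inftyValuation K
  let u : Valuation (RatFunc K) ℤᵐ⁰ := ν.map (powMonoidWithZeroHom hm0)
    (fun x y h => pow_le_pow_left' h m)
  have hu : ∀ f, u f = ν f ^ m := fun _ => rfl
  have huP : ∀ p : K[X], p ≠ 0 → u (algebraMap K[X] (RatFunc K) p) =
      WithZero.exp ((m : ℤ) * (p.natDegree : ℤ)) := by
    intro p hp
    rw [hu, RatFunc.inftyValuation_apply, RatFunc.inftyValuation.polynomial K hp,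
      ← WithZero.exp_nsmul, nsmul_eq_mul]
  let aP : K[X] → RatFunc K := algebraMap K[X] (RatFunc K)
  let Cp : (RatFunc K)[X] := ∑ j : Fin m, monomial (j : ℕ) (c j)
  let E : (RatFunc K)[X] := monomial m (aP N) -
    ∑ j : Fin m, monomial (m - 1 - (j : ℕ)) (aP (P j))
  have hE : E = ∑ i : Fin m, C (b i) * (dP θ)^[i] Cp := by
    refine Polynomial.eq_of_infinite_eval_eq _ _
      (Set.infinite_of_injective_forall_mem (f := fun n : ℕ => (n : RatFunc K))
        Nat.cast_injective fun n => ?_)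
    have h1 := congrArg (fun T => T (iotaRF K (RatFunc.X ^ n))) hbc
    simp only [polyMulOp] at h1
    rw [endo_sub_apply, endo_mul_apply, endo_mul_apply,
      op_iota K θ hθ, op_iota K θ hθ, op_iota K θ hθ, eulerOp_pow_iota K θ hθ, mulOp_iota,
      ← map_mul, ← map_sub] at h1
    have h2 := hinj h1
    have h3 : ∑ i : Fin m, c i * θ^[i] (RatFunc.X ^ n) = Cp.eval (n : RatFunc K) * RatFunc.X ^ n := by
      rw [eval_finsetSum, Finset.sum_mul]
      refine Finset.sum_congr rfl fun j _ => ?_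
      rw [eval_monomial, hθX]
      ring
    rw [h3] at h2
    simp only [hθev, hθX] at h2
    have hXn : (RatFunc.X : RatFunc K) ^ n ≠ 0 := pow_ne_zero _ RatFunc.X_ne_zero
    simp only [Set.mem_ofPred_eq]
    apply mul_right_cancel₀ hXn
    rw [eval_sub, eval_finsetSum, eval_finsetSum, sub_mul, Finset.sum_mul, Finset.sum_mul]
    simp only [eval_monomial, eval_mul, eval_C, mul_assoc]
    exact h2
  have hEm : E.coeff m = aP N := by
    simp only [E, coeff_sub, finsetSum_coeff, coeff_monomial, if_true]
    rw [Finset.sum_eq_zero, sub_zero]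
    intro j _
    rw [if_neg (by omega)]
  have hElt : ∀ l (hl : l < m), E.coeff l = - aP (P ⟨m - 1 - l, by omega⟩) := by
    intro l hl
    simp only [E, coeff_sub, finsetSum_coeff, coeff_monomial]
    rw [if_neg (by omega), zero_sub, Finset.sum_eq_single ⟨m - 1 - l, by omega⟩]
    · rw [if_pos]
      simp only
      omega
    · intro j _ hj
      rw [if_neg]
      intro h
      exact hj (Fin.ext (by simp only; omega))
    · simp
  have hEgt : ∀ l, m < l → E.coeff l = 0 := by
    intro l hl
    simp only [E, coeff_sub, finsetSum_coeff, coeff_monomial]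
    rw [if_neg (by omega), zero_sub, Finset.sum_eq_zero, neg_zero]
    intro j _
    rw [if_neg (by omega)]
  have haN : aP N ≠ 0 := by simpa [aP] using hN
  have hb : ∃ i, b i ≠ 0 := by
    by_contra! h
    apply haN
    rw [← hEm, hE]
    simp [h]
  have hdP0 : ∀ i, (dP θ)^[i] 0 = 0 := by
    intro i
    have h0 : dP θ 0 = 0 := by simp [dP, thetaP]
    exact Function.iterate_fixed h0 i
  have hc : ∃ i, c i ≠ 0 := by
    by_contra! h
    apply haN
    rw [← hEm, hE]
    have : Cp = 0 := by simp [Cp, h]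
    simp [this, hdP0]
  obtain ⟨k, W, hk, hl⟩ := core (u := u) θ (fun f => pow_le_pow_left' (hθv f) m)
    (fun f hf => ⟨f.intDegree, by
      rw [hu, RatFunc.inftyValuation_apply, RatFunc.inftyValuation_of_nonzero K hf,
        ← WithZero.exp_nsmul, nsmul_eq_mul]⟩) b c hb hc E hE
  set S := N.natDegree with hS
  have hdN : N.degree + 1 = ((S + 1 : ℕ) : WithBot ℕ) := by
    rw [degree_eq_natDegree hN]
    rfl
  have hwm : u (E.coeff m) * WithZero.exp (m : ℤ) = WithZero.exp ((m : ℤ) * S + m) := by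
    rw [hEm, huP N hN, ← WithZero.exp_add]
  have hw0 : u (E.coeff 0) * WithZero.exp ((0 : ℕ) : ℤ) = WithZero.exp ((m : ℤ) * S + m) := by
    rw [hdN] at hPm
    have hP0 : P ⟨m - 1, by omega⟩ ≠ 0 := by
      intro h
      rw [h, degree_zero] at hPm
      exact WithBot.bot_ne_coe hPm
    rw [hElt 0 (by omega), Valuation.map_neg]
    simp only [Nat.sub_zero, aP]
    rw [huP _ hP0, natDegree_eq_of_degree_eq_some hPm, ← WithZero.exp_add]
    congr 1
  have hwl : ∀ l, l ≠ 0 → l ≠ m →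
      u (E.coeff l) * WithZero.exp (l : ℤ) < WithZero.exp ((m : ℤ) * S + m) := by
    intro l h0 h1
    rcases lt_or_gt_of_ne h1 with h | h
    · rw [hElt l h, Valuation.map_neg]
      have hP := hPj ⟨m - 1 - l, by omega⟩ (by simp only; omega)
      by_cases hP0 : P ⟨m - 1 - l, by omega⟩ = 0
      · rw [hP0]
        simp [aP]
      · rw [hdN] at hP
        have hd := (natDegree_lt_iff_degree_lt hP0).2 hP
        simp only [aP]
        rw [huP _ hP0, ← WithZero.exp_add, WithZero.exp_lt_exp]
        have hd' : ((P ⟨m - 1 - l, by omega⟩).natDegree : ℤ) ≤ S := by omega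
        have := mul_le_mul_of_nonneg_left hd' (Int.natCast_nonneg m)
        omega
    · rw [hEgt l h]
      simp
  by_cases hk0 : k = 0
  · subst hk0
    have h1 := hl m hm0
    rw [hwm, ← hk, hw0] at h1
    exact lt_irrefl _ h1
  · have h1 := hl 0 (Ne.symm hk0)
    rw [hw0, ← hk] at h1
    by_cases hkm : k = m
    · subst hkm
      rw [hwm] at h1
      exact lt_irrefl _ h1
    · exact lt_asymm h1 (hwl k hk0 hkm)
end

section
/- Let E = T(t)D^m - Q_1(t)D^{m-1} - ... - Q_m(t) with T, Q_j ∈ K[t]. If either (a) S' = deg T ≥ 0, deg Q_m = S'+1 and deg Q_j < S'+1 for j < m, or (b) r'_m = deg Q_m ≥ 0, deg T = r'_m + 1 and deg Q_j ≤ r'_m for all j, then E is irreducible in the ring K(t)[D] of differential operators. -/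
open Polynomial

/-- The derivative `D = d/dt` on `K((t))`: `D(Σ aₙ tⁿ) = Σ n aₙ tⁿ⁻¹`. -/
noncomputable def derivOp (K : Type*) [Field K] : AddMonoid.End (LaurentSeries K) :=
  AddMonoidHom.mk' (fun f =>
    ⟨fun n => ((n + 1 : ℤ) : K) * f.coeff (n + 1),
      ((f.isPWO_support'.image_of_monotone
          (fun a b hab => sub_le_sub_right hab 1 : Monotone fun x : ℤ => x - 1)).mono
        (fun n hn => by
          simp only [Function.mem_support] at hn
          exact ⟨n + 1, right_ne_zero_of_mul hn, by ring⟩))⟩)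
    (fun f g => by ext n; simp [mul_add])

namespace Aux

open HahnSeries

variable {K : Type*} [Field K]

lemma derivOp_coeff (f : LaurentSeries K) (n : ℤ) :
    (derivOp K f).coeff n = ((n + 1 : ℤ) : K) * f.coeff (n + 1) := rfl

/-- rational functions inside Laurent series -/
noncomputable def jo (K : Type*) [Field K] : RatFunc K →+* LaurentSeries K :=
  open scoped RatFunc in algebraMap (RatFunc K) (LaurentSeries K)

lemma mulOp_apply (f : RatFunc K) (h : LaurentSeries K) :
    mulOp K f h = jo K f * h := rfl

/-- polynomials inside Laurent series -/
noncomputable def polyL (p : Polynomial K) : LaurentSeries K :=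
  jo K (algebraMap (Polynomial K) (RatFunc K) p)

lemma polyL_def (p : Polynomial K) : jo K (algebraMap (Polynomial K) (RatFunc K) p) = polyL p := rfl

lemma polyL_add (p q : Polynomial K) : polyL (p + q) = polyL p + polyL q := by simp [polyL]
lemma polyL_mul (p q : Polynomial K) : polyL (p * q) = polyL p * polyL q := by simp [polyL]
lemma polyL_X : polyL (Polynomial.X : Polynomial K) = single (1:ℤ) (1:K) := by
  simp only [polyL, RatFunc.algebraMap_X]
  exact RatFunc.coe_X
lemma polyL_C (a : K) : polyL (Polynomial.C a) = single (0:ℤ) a := by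
  have : polyL (Polynomial.C a) = algebraMap (Polynomial K) (LaurentSeries K) (Polynomial.C a) := by
    open scoped RatFunc in
    exact (IsScalarTower.algebraMap_apply _ (RatFunc K) (LaurentSeries K) _).symm
  rw [this]
  simp

lemma polyL_ne {p : Polynomial K} (hp : p ≠ 0) : polyL p ≠ 0 := by
  simpa [polyL] using hp

lemma deriv_X_mul (g : LaurentSeries K) :
    derivOp K (single (1:ℤ) (1:K) * g) = g + single (1:ℤ) (1:K) * derivOp K g := by
  ext n
  have h1 : (single (1:ℤ) (1:K) * g).coeff (n + 1) = 1 * g.coeff n := by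
    rw [coeff_single_mul_add]
  have h2 : (single (1:ℤ) (1:K) * derivOp K g).coeff n = 1 * (derivOp K g).coeff (n-1) := by
    rw [coeff_single_mul]
  rw [derivOp_coeff, HahnSeries.coeff_add, h1, h2, derivOp_coeff]
  simp
  ring

lemma deriv_C_mul (a : K) (g : LaurentSeries K) :
    derivOp K (single (0:ℤ) a * g) = single (0:ℤ) a * derivOp K g := by
  ext n
  rw [derivOp_coeff, coeff_single_mul, coeff_single_mul, derivOp_coeff]
  simp
  ring

lemma deriv_polyL_mul (p : Polynomial K) : ∀ g : LaurentSeries K,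
    derivOp K (polyL p * g) = polyL (derivative p) * g + polyL p * derivOp K g := by
  induction p using Polynomial.induction_on' with
  | add p q hp hq =>
    intro g
    rw [polyL_add, add_mul, map_add, hp, hq, derivative_add, polyL_add]; ring
  | monomial n a =>
    rw [← Polynomial.C_mul_X_pow_eq_monomial]
    induction n with
    | zero => intro g; rw [pow_zero, mul_one, polyL_C, deriv_C_mul, derivative_C]; simp [polyL]
    | succ n ih =>
      intro g
      rw [pow_succ, ← mul_assoc, polyL_mul, mul_assoc, ih, polyL_X, deriv_X_mul,
        derivative_mul (f := Polynomial.C a * X ^ n), polyL_add,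
        polyL_mul (derivative (Polynomial.C a * X ^ n)), polyL_mul _ (derivative X), derivative_X, polyL_X]
      have : polyL (1 : Polynomial K) = 1 := by simp [polyL]
      rw [this]; ring

lemma deriv_one : derivOp K (1 : LaurentSeries K) = 0 := by
  ext n
  rw [derivOp_coeff, HahnSeries.coeff_one]
  by_cases h : n + 1 = 0 <;> simp [h]

lemma deriv_polyL (p : Polynomial K) : derivOp K (polyL p) = polyL (derivative p) := by
  have := deriv_polyL_mul p 1
  simpa [deriv_one] using this

lemma deriv_pow_polyL (p : Polynomial K) (k : ℕ) :
    (derivOp K ^ k) (polyL p) = polyL (derivative^[k] p) := by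
  induction k with
  | zero => simp
  | succ k ih => rw [pow_succ', Function.iterate_succ_apply', ← deriv_polyL, ← ih]; rfl

/-- The degree of `f` at infinity plus `a`... : `f = 0` or `deg f ≤ n`. -/
def DegLe (f : RatFunc K) (n : ℤ) : Prop := f = 0 ∨ f.intDegree ≤ n

lemma DegLe.add {f g : RatFunc K} {n : ℤ} (hf : DegLe f n) (hg : DegLe g n) :
    DegLe (f + g) n := by
  by_cases h0 : f + g = 0
  · exact Or.inl h0
  by_cases hg0 : g = 0
  · simpa [hg0] using hf
  by_cases hf0 : f = 0
  · simpa [hf0] using hg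
  right
  exact (RatFunc.intDegree_add_le hg0 h0).trans
    (max_le (hf.resolve_left hf0) (hg.resolve_left hg0))

lemma DegLe.mul {f g : RatFunc K} {n k : ℤ} (hf : DegLe f n) (hg : DegLe g k) :
    DegLe (f * g) (n + k) := by
  by_cases hg0 : g = 0
  · simp [hg0, DegLe]
  by_cases hf0 : f = 0
  · simp [hf0, DegLe]
  right
  rw [RatFunc.intDegree_mul hf0 hg0]
  exact add_le_add (hf.resolve_left hf0) (hg.resolve_left hg0)

lemma DegLe.neg {f : RatFunc K} {n : ℤ} (hf : DegLe f n) : DegLe (-f) n := by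
  simpa [DegLe] using hf

lemma natDegree_wronsk (p q : Polynomial K) (h : derivative p * q - p * derivative q ≠ 0) :
    (derivative p * q - p * derivative q).natDegree + 1 ≤ p.natDegree + q.natDegree := by
  have aux : ∀ a b : Polynomial K, derivative a * b ≠ 0 →
      (derivative a * b).natDegree + 1 ≤ a.natDegree + b.natDegree := by
    intro a b hab
    have h1 : a.natDegree ≠ 0 := by
      intro h0
      apply hab
      rw [Polynomial.eq_C_of_natDegree_eq_zero h0]; simp
    have h2 := Polynomial.natDegree_derivative_lt h1
    have h3 := Polynomial.natDegree_mul_le (p := derivative a) (q := b)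
    omega
  by_cases h1 : derivative p * q = 0
  · rw [h1, zero_sub] at h ⊢
    rw [Polynomial.natDegree_neg]
    have := aux q p (by rw [mul_comm]; exact neg_ne_zero.1 h)
    rw [mul_comm]; omega
  have h1' := aux p q h1
  by_cases h2 : p * derivative q = 0
  · rw [h2, sub_zero]; exact h1'
  have h2' := aux q p (by rw [mul_comm]; exact h2)
  rw [mul_comm] at h2'
  have := Polynomial.natDegree_sub_le (derivative p * q) (p * derivative q)
  have h3 : max (derivative p * q).natDegree (p * derivative q).natDegree + 1 ≤ p.natDegree + q.natDegree := by
    rcases max_cases (derivative p * q).natDegree (p * derivative q).natDegree with h | h <;> omega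
  omega

lemma End_add_apply {M : Type*} [AddCommGroup M] (x y : AddMonoid.End M) (h : M) :
    (x + y) h = x h + y h := rfl

lemma End_mul_apply {M : Type*} [AddCommGroup M] (x y : AddMonoid.End M) (h : M) :
    (x * y) h = x (y h) := rfl

lemma exists_deriv (f : RatFunc K) : ∃ g : RatFunc K,
    derivOp K * mulOp K f = mulOp K g + mulOp K f * derivOp K ∧
    (∀ n, DegLe f n → DegLe g (n - 1)) := by
  set p := f.num with hp
  set q := f.denom with hq
  have hq0 : q ≠ 0 := f.denom_ne_zero
  have hf : f = algebraMap _ _ p / algebraMap _ _ q := (RatFunc.num_div_denom f).symm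
  have hq0' : algebraMap (Polynomial K) (RatFunc K) q ≠ 0 := by simpa using hq0
  refine ⟨algebraMap _ _ (derivative p * q - p * derivative q) / algebraMap _ _ (q * q), ?_, ?_⟩
  · ext1 h
    have hqi := polyL_ne hq0
    obtain ⟨k, rfl⟩ : ∃ k, h = polyL q * k := ⟨(polyL q)⁻¹ * h, by field_simp⟩
    rw [End_add_apply, End_mul_apply, End_mul_apply, mulOp_apply,
      mulOp_apply, mulOp_apply]
    have e1 : jo K f * (polyL q * k) = polyL p * k := by
      have : jo K f = polyL p / polyL q := by
        rw [hf, map_div₀, polyL_def, polyL_def]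
      rw [this]; field_simp
    have e2 : jo K f = polyL p / polyL q := by
        rw [hf, map_div₀, polyL_def, polyL_def]
    rw [e1, deriv_polyL_mul, deriv_polyL_mul, e2]
    rw [map_div₀, polyL_def, polyL_def]
    have e3 : polyL (derivative p * q - p * derivative q) =
      polyL (derivative p) * polyL q - polyL p * polyL (derivative q) := by simp [polyL]
    rw [e3, polyL_mul]
    field_simp
    ring
  · intro n hn
    by_cases hw : derivative p * q - p * derivative q = 0
    · left; simp [hw]
    have hp0 : p ≠ 0 := by rintro h; rw [h] at hw; simp at hw
    have hf0 : f ≠ 0 := by rw [hf]; simp [hp0, hq0]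
    right
    have hn := hn.resolve_left hf0
    have := natDegree_wronsk p q hw
    rw [RatFunc.intDegree_div ((map_ne_zero_iff _ (RatFunc.algebraMap_injective K)).2 hw) (by simp [hq0]),
      RatFunc.intDegree_polynomial, RatFunc.intDegree_polynomial, Polynomial.natDegree_mul hq0 hq0]
    have : f.intDegree = p.natDegree - q.natDegree := by rw [RatFunc.intDegree]
    push_cast
    omega

/-- multiplication operators as a ring hom -/
noncomputable def mulHom (K : Type*) [Field K] : RatFunc K →+* AddMonoid.End (LaurentSeries K) where
  toFun := mulOp K
  map_one' := by ext1 h; rw [mulOp_apply, map_one, one_mul]; rfl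
  map_zero' := by ext1 h; rw [mulOp_apply, map_zero, zero_mul]; rfl
  map_add' f g := by
    ext1 h; rw [End_add_apply, mulOp_apply, mulOp_apply, mulOp_apply, map_add, add_mul]
  map_mul' f g := by
    ext1 h; rw [End_mul_apply, mulOp_apply, mulOp_apply, mulOp_apply, map_mul, mul_assoc]

lemma mulHom_eq (f : RatFunc K) : mulHom K f = mulOp K f := rfl

/-- the operator `Σ e_k D^k` -/
noncomputable def Phi (K : Type*) [Field K] : (ℕ →₀ RatFunc K) →+ AddMonoid.End (LaurentSeries K) :=
  Finsupp.liftAddHom (fun k =>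
    (AddMonoidHom.mulRight (derivOp K ^ k)).comp (mulHom K).toAddMonoidHom)

lemma Phi_single (k : ℕ) (a : RatFunc K) :
    Phi K (Finsupp.single k a) = mulHom K a * derivOp K ^ k := by
  simp [Phi]

lemma Phi_eq (e : ℕ →₀ RatFunc K) :
    Phi K e = ∑ k ∈ e.support, mulHom K (e k) * derivOp K ^ k := by
  conv_lhs => rw [← Finsupp.sum_single e, Finsupp.sum, map_sum]
  simp only [Phi_single]

lemma End_sum_apply {M ι : Type*} [AddCommGroup M] (s : Finset ι) (x : ι → AddMonoid.End M) (h : M) :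
    (∑ i ∈ s, x i) h = ∑ i ∈ s, x i h := by
  classical
  induction s using Finset.induction_on with
  | empty => simp
  | insert a s ha ih => rw [Finset.sum_insert ha, Finset.sum_insert ha, End_add_apply, ih]

lemma Phi_inj [CharZero K] (e : ℕ →₀ RatFunc K) (h : Phi K e = 0) : e = 0 := by
  by_contra hne
  have hs : ∃ k, e k ≠ 0 := by
    by_contra hh
    push Not at hh
    exact hne (Finsupp.ext hh)
  classical
  set k := Nat.find hs with hk
  have hk0 : e k ≠ 0 := Nat.find_spec hs
  have hmin : ∀ j, j < k → e j = 0 := fun j hj => by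
    by_contra h'; exact Nat.find_min hs hj h'
  have h1 : Phi K e (polyL (X ^ k)) = 0 := by rw [h]; rfl
  rw [Phi_eq, End_sum_apply, Finset.sum_eq_single k] at h1
  · rw [End_mul_apply, deriv_pow_polyL, mulHom_eq, mulOp_apply,
      Polynomial.iterate_derivative_X_pow_eq_natCast_mul] at h1
    rcases mul_eq_zero.1 h1 with h2 | h2
    · exact hk0 ((map_eq_zero (jo K)).1 h2)
    · refine polyL_ne ?_ h2
      simp [Nat.descFactorial_self, Nat.factorial_ne_zero]
  · intro j hj hjk
    rw [End_mul_apply, deriv_pow_polyL]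
    have : k < j := by
      rcases lt_or_gt_of_ne hjk with h | h
      · exact absurd (hmin j h) (Finsupp.mem_support_iff.1 hj)
      · exact h
    rw [Polynomial.iterate_derivative_X_pow_eq_natCast_mul, Nat.descFactorial_of_lt this]
    simp [polyL]
  · intro hk'
    exact absurd (Finsupp.mem_support_iff.2 hk0) hk'

/-- weight bound -/
def WtLe (m : ℕ) (w : ℤ) (a : RatFunc K) (k : ℕ) (W : ℤ) : Prop :=
  a = 0 ∨ (m : ℤ) * a.intDegree + w * k ≤ W

section wt
variable {m : ℕ} {w : ℤ}

lemma WtLe.zero {k W} : WtLe m w (0 : RatFunc K) k W := Or.inl rfl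

lemma WtLe.mono {a : RatFunc K} {k W V} (h : WtLe m w a k W) (hWV : W ≤ V) : WtLe m w a k V :=
  h.imp id (fun h => h.trans hWV)

lemma WtLe.add {f g : RatFunc K} {k W} (hf : WtLe m w f k W) (hg : WtLe m w g k W) :
    WtLe m w (f + g) k W := by
  by_cases h0 : f + g = 0
  · exact Or.inl h0
  by_cases hg0 : g = 0
  · simpa [hg0] using hf
  by_cases hf0 : f = 0
  · simpa [hf0] using hg
  right
  have h1 := hf.resolve_left hf0
  have h2 := hg.resolve_left hg0
  have hm : (0:ℤ) ≤ m := by positivity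
  have h3 := RatFunc.intDegree_add_le hg0 h0
  rcases le_max_iff.1 h3 with h | h
  · have := mul_le_mul_of_nonneg_left h hm; linarith
  · have := mul_le_mul_of_nonneg_left h hm; linarith

lemma WtLe.neg {f : RatFunc K} {k W} (hf : WtLe m w f k W) : WtLe m w (-f) k W := by
  simpa [WtLe] using hf

lemma WtLe.sum {ι : Type*} (s : Finset ι) (f : ι → RatFunc K) {k W}
    (hf : ∀ i ∈ s, WtLe m w (f i) k W) : WtLe m w (∑ i ∈ s, f i) k W :=
  Finset.sum_induction f (fun a => WtLe m w a k W) (fun _ _ => WtLe.add) WtLe.zero hf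

/-- operators of weight at most `W` -/
def N (K : Type*) [Field K] (m : ℕ) (w W : ℤ) : AddSubgroup (AddMonoid.End (LaurentSeries K)) where
  carrier := {x | ∃ e : ℕ →₀ RatFunc K, x = Phi K e ∧ ∀ k, WtLe m w (e k) k W}
  zero_mem' := ⟨0, by simp, fun k => WtLe.zero⟩
  add_mem' := by
    rintro _ _ ⟨e, rfl, he⟩ ⟨f, rfl, hf⟩
    exact ⟨e + f, by simp, fun k => (he k).add (hf k)⟩
  neg_mem' := by
    rintro _ ⟨e, rfl, he⟩
    exact ⟨-e, by simp, fun k => (he k).neg⟩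

lemma N_mono {W V : ℤ} (h : W ≤ V) {x} (hx : x ∈ N K m w W) : x ∈ N K m w V := by
  obtain ⟨e, rfl, he⟩ := hx
  exact ⟨e, rfl, fun k => (he k).mono h⟩

lemma N_single {a : RatFunc K} {k W} (h : WtLe m w a k W) :
    mulHom K a * derivOp K ^ k ∈ N K m w W := by
  refine ⟨Finsupp.single k a, (Phi_single _ _).symm, fun j => ?_⟩
  by_cases hj : k = j
  · subst hj; simpa using h
  · rw [Finsupp.single_eq_of_ne (by tauto)]; exact WtLe.zero

lemma N_ind {W : ℤ} (S : AddSubgroup (AddMonoid.End (LaurentSeries K)))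
    (F : AddMonoid.End (LaurentSeries K) →+ AddMonoid.End (LaurentSeries K))
    (h : ∀ a k, WtLe m w a k W → F (mulHom K a * derivOp K ^ k) ∈ S) :
    ∀ x ∈ N K m w W, F x ∈ S := by
  rintro _ ⟨e, rfl, he⟩
  rw [Phi_eq, map_sum]
  exact S.sum_mem fun k _ => h _ _ (he k)

lemma deriv_comm (f : RatFunc K) : ∃ g : RatFunc K,
    derivOp K * mulHom K f = mulHom K g + mulHom K f * derivOp K ∧
    (∀ k W, WtLe m w f k W → WtLe m w g k (W - m)) := by
  obtain ⟨g, h1, h2⟩ := exists_deriv f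
  refine ⟨g, h1, fun k W hW => ?_⟩
  by_cases hg : g = 0
  · exact Or.inl hg
  by_cases hf : f = 0
  · exact absurd ((h2 (g.intDegree) (Or.inl hf)).resolve_left hg) (by omega)
  right
  have h3 := (h2 f.intDegree (Or.inr le_rfl)).resolve_left hg
  have h4 := hW.resolve_left hf
  have hm : (0:ℤ) ≤ m := by positivity
  have := mul_le_mul_of_nonneg_left h3 hm
  linarith

lemma N_D (hmw : 1 ≤ m + w) {W : ℤ} {x} (hx : x ∈ N K m w W) :
    derivOp K * x ∈ N K m w (W + w) := by
  refine N_ind (N K m w (W + w)) (AddMonoidHom.mulLeft (derivOp K)) ?_ x hx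
  intro a k ha
  obtain ⟨g, h1, h2⟩ := deriv_comm (m := m) (w := w) a
  rw [AddMonoidHom.coe_mulLeft, ← mul_assoc, h1, add_mul, mul_assoc, ← pow_succ']
  refine add_mem (N_single ((h2 k W ha).mono (by omega))) (N_single ?_)
  refine ha.imp id (fun h => ?_)
  push_cast
  linarith

lemma N_mulHom {W : ℤ} {x} (hx : x ∈ N K m w W) {f : RatFunc K} (hf : f ≠ 0) :
    mulHom K f * x ∈ N K m w (m * f.intDegree + W) := by
  refine N_ind (N K m w _) (AddMonoidHom.mulLeft (mulHom K f)) ?_ x hx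
  intro a k ha
  rw [AddMonoidHom.coe_mulLeft, ← mul_assoc, ← map_mul]
  apply N_single
  by_cases ha0 : a = 0
  · left; simp [ha0]
  right
  rw [RatFunc.intDegree_mul hf ha0]
  have := ha.resolve_left ha0
  linarith

lemma key1 (hmw : 1 ≤ m + w) (g : RatFunc K) (j : ℕ) (V : ℤ) (hV : WtLe m w g j V) (i : ℕ) :
    derivOp K ^ i * (mulHom K g * derivOp K ^ j) - mulHom K g * derivOp K ^ (i + j)
      ∈ N K m w (w * i + V - 1) := by
  induction i with
  | zero => simp [zero_mem]
  | succ i ih =>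
    obtain ⟨g', h1, h2⟩ := deriv_comm (m := m) (w := w) g
    have : derivOp K ^ (i+1) * (mulHom K g * derivOp K ^ j) - mulHom K g * derivOp K ^ (i + 1 + j)
       = derivOp K * (derivOp K ^ i * (mulHom K g * derivOp K ^ j) - mulHom K g * derivOp K ^ (i + j))
        + mulHom K g' * derivOp K ^ (i + j) := by
      have e : mulHom K g' = derivOp K * mulHom K g - mulHom K g * derivOp K := by
        rw [h1]; abel
      rw [e, show i + 1 + j = (i + j) + 1 by ring, pow_succ' _ i, pow_succ' _ (i + j)]
      simp only [mul_sub, sub_mul, mul_assoc]; abel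
    rw [this]
    refine add_mem (N_mono (by push_cast; linarith) (N_D hmw ih)) (N_single ?_)
    refine (h2 j V hV).imp id (fun h => ?_)
    push_cast
    linarith

lemma key2 (hmw : 1 ≤ m + w) (f g : RatFunc K) (i j : ℕ) (W V : ℤ) (hW : WtLe m w f i W)
    (hV : WtLe m w g j V) :
    (mulHom K f * derivOp K ^ i) * (mulHom K g * derivOp K ^ j) -
      mulHom K (f * g) * derivOp K ^ (i + j) ∈ N K m w (W + V - 1) := by
  by_cases hf : f = 0
  · simp [hf, zero_mem]
  have h := N_mulHom (key1 hmw g j V hV i) hf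
  have e : (mulHom K f * derivOp K ^ i) * (mulHom K g * derivOp K ^ j) -
      mulHom K (f * g) * derivOp K ^ (i + j) = mulHom K f *
      (derivOp K ^ i * (mulHom K g * derivOp K ^ j) - mulHom K g * derivOp K ^ (i + j)) := by
    rw [map_mul]; simp only [mul_sub, mul_assoc]
  rw [e]
  refine N_mono ?_ h
  have := hW.resolve_left hf
  linarith

lemma WtLe.mul {f g : RatFunc K} {i j W V} (hf : WtLe m w f i W) (hg : WtLe m w g j V) :
    WtLe m w (f * g) (i + j) (W + V) := by
  by_cases hf0 : f = 0
  · left; simp [hf0]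
  by_cases hg0 : g = 0
  · left; simp [hg0]
  right
  rw [RatFunc.intDegree_mul hf0 hg0]
  have := hf.resolve_left hf0
  have := hg.resolve_left hg0
  push_cast
  linarith

lemma N_mul (hmw : 1 ≤ m + w) {W V : ℤ} {x y} (hx : x ∈ N K m w W) (hy : y ∈ N K m w V) :
    x * y ∈ N K m w (W + V) := by
  refine N_ind (N K m w _) (AddMonoidHom.mulRight y) ?_ x hx
  intro a i ha
  refine N_ind (N K m w _) (AddMonoidHom.mulLeft (mulHom K a * derivOp K ^ i)) ?_ y hy
  intro b j hb
  have h1 := N_mono (by omega) (key2 hmw a b i j W V ha hb) (V := W + V)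
  have h2 := N_single (ha.mul hb)
  have := add_mem h1 h2
  rwa [sub_add_cancel] at this

lemma lead (hw : w = 1 ∨ w = -1) (b : Fin m → RatFunc K) (hb : ∃ i, b i ≠ 0) :
    ∃ i, b i ≠ 0 ∧ (∑ i, mulHom K (b i) * derivOp K ^ (i : ℕ)) - mulHom K (b i) * derivOp K ^ (i : ℕ)
      ∈ N K m w (m * (b i).intDegree + w * (i : ℕ) - 1) := by
  classical
  obtain ⟨i0, hi0⟩ := hb
  obtain ⟨i, hi, hmax⟩ := Finset.exists_max_image (Finset.univ.filter fun i => b i ≠ 0)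
    (fun i => (m : ℤ) * (b i).intDegree + w * (i : ℕ)) ⟨i0, by simpa using hi0⟩
  refine ⟨i, by simpa using hi, ?_⟩
  rw [← Finset.add_sum_erase _ _ (Finset.mem_univ i), add_sub_cancel_left]
  refine sum_mem fun k hk => N_single ?_
  by_cases hk0 : b k = 0
  · exact Or.inl hk0
  right
  have h1 := hmax k (by simpa using hk0)
  have hne : (m : ℤ) * (b k).intDegree + w * (k : ℕ) ≠ m * (b i).intDegree + w * (i : ℕ) := by
    intro h
    apply Finset.ne_of_mem_erase hk
    have hd : (m : ℤ) ∣ (k : ℕ) - (i : ℕ) := by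
      rcases hw with rfl | rfl
      · exact ⟨(b i).intDegree - (b k).intDegree, by linarith⟩
      · exact ⟨(b k).intDegree - (b i).intDegree, by linarith⟩
    have h0 := Int.eq_zero_of_abs_lt_dvd hd (by
      have := k.2; have := i.2
      rw [abs_lt]; constructor <;> omega)
    ext; omega
  omega

lemma main (hm : 0 < m) [CharZero K] (hmw : 1 ≤ m + w) (hw : w = 1 ∨ w = -1) (b c : Fin m → RatFunc K)
    (e : ℕ →₀ RatFunc K) (M : ℤ) (he : ∀ k, WtLe m w (e k) k M) (h0 : e 0 ≠ 0) (hm0 : e m ≠ 0)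
    (h0M : m * (e 0).intDegree = M) (hmM : m * (e m).intDegree + w * m = M)
    (heq : Phi K e = (∑ i, mulHom K (b i) * derivOp K ^ (i : ℕ)) *
      (∑ i, mulHom K (c i) * derivOp K ^ (i : ℕ))) : False := by
  by_cases hb : ∃ i, b i ≠ 0
  swap
  · push Not at hb
    simp only [hb, map_zero, zero_mul, Finset.sum_const_zero] at heq
    exact h0 (by rw [Phi_inj e heq]; rfl)
  by_cases hc : ∃ i, c i ≠ 0
  swap
  · push Not at hc
    simp only [hc, map_zero, zero_mul, Finset.sum_const_zero, mul_zero] at heq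
    exact h0 (by rw [Phi_inj e heq]; rfl)
  obtain ⟨i, hbi, hB⟩ := lead hw b hb
  obtain ⟨j, hcj, hC⟩ := lead hw c hc
  set B := ∑ i, mulHom K (b i) * derivOp K ^ (i : ℕ)
  set C := ∑ i, mulHom K (c i) * derivOp K ^ (i : ℕ)
  set U := (m : ℤ) * (b i).intDegree + w * (i : ℕ) with hU
  set V := (m : ℤ) * (c j).intDegree + w * (j : ℕ) with hV
  have hbU : WtLe m w (b i) i U := Or.inr le_rfl
  have hcV : WtLe m w (c j) j V := Or.inr le_rfl
  have hmem : B * C - mulHom K (b i * c j) * derivOp K ^ ((i : ℕ) + j) ∈ N K m w (U + V - 1) := by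
    have hCV : C ∈ N K m w V := by
      have := add_mem (N_mono (by omega) hC) (N_single hcV)
      rwa [sub_add_cancel] at this
    have h1 := N_mono (by omega) (N_mul hmw hB hCV) (V := U + V - 1)
    have h2 := N_mono (by omega) (N_mul hmw (N_single hbU) hC) (V := U + V - 1)
    have h3 := key2 hmw _ _ _ _ _ _ hbU hcV
    have h4 := add_mem (add_mem h1 h2) h3
    convert h4 using 1
    simp only [mul_sub, sub_mul, mul_assoc]; abel
  obtain ⟨n, hn, hnW⟩ := hmem
  set s := (i : ℕ) + j
  have hs : e = Finsupp.single s (b i * c j) + n := by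
    rw [← sub_eq_zero]
    apply Phi_inj
    rw [map_sub, map_add, ← hn, Phi_single, heq]
    abel
  have hMW : M ≤ U + V - 1 := by
    by_cases hs0 : s = 0
    · have : e m = n m := by
        rw [hs, Finsupp.add_apply, Finsupp.single_eq_of_ne (by omega), zero_add]
      have h := hnW m
      rw [← this] at h
      have := h.resolve_left hm0
      linarith
    · have : e 0 = n 0 := by
        rw [hs, Finsupp.add_apply, Finsupp.single_eq_of_ne (by omega), zero_add]
      have h := hnW 0
      rw [← this] at h
      have := h.resolve_left h0
      simp at this
      linarith
  have hbc : b i * c j = e s + -n s := by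
    rw [hs]; simp
  have hfin : WtLe m w (b i * c j) s (U + V - 1) := by
    rw [hbc]; exact ((he s).mono hMW).add (hnW s).neg
  have := hfin.resolve_left (mul_ne_zero hbi hcj)
  rw [RatFunc.intDegree_mul hbi hcj] at this
  simp only [s] at this
  push_cast at this
  linarith

end wt

lemma setup [CharZero K] (m : ℕ) (hm : 2 ≤ m) (w : ℤ) (hmw : 1 ≤ m + w) (hw : w = 1 ∨ w = -1)
    (T : Polynomial K) (Q : Fin m → Polynomial K) (M : ℤ)
    (hT : T ≠ 0) (hQ : Q ⟨m - 1, by omega⟩ ≠ 0)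
    (hTM : m * (T.natDegree : ℤ) + w * m = M)
    (hQM : m * ((Q ⟨m - 1, by omega⟩).natDegree : ℤ) = M)
    (hle : ∀ j : Fin m, Q j = 0 ∨ m * ((Q j).natDegree : ℤ) + w * ((m - 1 - (j : ℕ) : ℕ) : ℤ) ≤ M)
    (b c : Fin m → RatFunc K)
    (heq : polyMulOp K T * derivOp K ^ m
          - ∑ j : Fin m, polyMulOp K (Q j) * derivOp K ^ (m - 1 - (j : ℕ)) =
        (∑ i : Fin m, mulOp K (b i) * derivOp K ^ (i : ℕ)) *
        (∑ i : Fin m, mulOp K (c i) * derivOp K ^ (i : ℕ))) : False := by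
  let al := algebraMap (Polynomial K) (RatFunc K)
  have al0 : ∀ p, p ≠ 0 → al p ≠ 0 := fun p hp =>
    (map_ne_zero_iff _ (RatFunc.algebraMap_injective K)).2 hp
  have ald : ∀ p, (al p).intDegree = p.natDegree := fun p => RatFunc.intDegree_polynomial
  let e : ℕ →₀ RatFunc K := Finsupp.single m (al T) -
    ∑ j : Fin m, Finsupp.single (m - 1 - (j : ℕ)) (al (Q j))
  have hek : ∀ k, e k = Finsupp.single m (al T) k -
    ∑ j : Fin m, Finsupp.single (m - 1 - (j : ℕ)) (al (Q j)) k := fun k => by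
      simp only [e, Finsupp.sub_apply, Finsupp.finsetSum_apply]
  have he0 : e 0 = - al (Q ⟨m - 1, by omega⟩) := by
    rw [hek, Finsupp.single_eq_of_ne (by omega), Finset.sum_eq_single ⟨m - 1, by omega⟩]
    · simp
    · intro j _ hj
      have : (j : ℕ) ≠ m - 1 := fun h => hj (Fin.ext h)
      rw [Finsupp.single_eq_of_ne (by have := j.2; omega)]
    · simp
  have hem : e m = al T := by
    rw [hek, Finsupp.single_eq_same, Finset.sum_eq_zero, sub_zero]
    intro j _
    rw [Finsupp.single_eq_of_ne (by omega)]
  refine main (by omega) hmw hw b c e M ?_ ?_ ?_ ?_ ?_ ?_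
  · intro k
    rw [hek, sub_eq_add_neg]
    refine WtLe.add ?_ (WtLe.neg (WtLe.sum _ _ fun j _ => ?_))
    · by_cases hk : k = m
      · subst hk
        right
        rw [Finsupp.single_eq_same, ald]; exact hTM.le
      · rw [Finsupp.single_eq_of_ne hk]; exact WtLe.zero
    · by_cases hk : k = m - 1 - (j : ℕ)
      · subst hk
        rw [Finsupp.single_eq_same]
        rcases hle j with h | h
        · left; rw [h]; exact map_zero al
        · right
          rw [ald]; exact h
      · rw [Finsupp.single_eq_of_ne hk]; exact WtLe.zero
  · rw [he0]; exact neg_ne_zero.2 (al0 _ hQ)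
  · rw [hem]; exact al0 _ hT
  · rw [he0, RatFunc.intDegree_neg, ald, hQM]
  · rw [hem, ald, hTM]
  · simp only [mulHom_eq]
    rw [← heq]
    simp only [e, map_sub, map_sum, Phi_single, mulHom_eq, polyMulOp, al]

end Aux

/-- **Corollary 4.2.** Let `E = T(t)D^m - Q₁(t)D^{m-1} - … - Q_m(t)` with `T, Q_j ∈ K[t]`.
If either (a) `S' = deg T ≥ 0`, `deg Q_m = S' + 1` and `deg Q_j < S' + 1` for `j < m`, or
(b) `r'_m = deg Q_m ≥ 0`, `deg T = r'_m + 1` and `deg Q_j ≤ r'_m` for all `j`, then `E` is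
irreducible in the ring `K(t)[D]` of differential operators: `E` cannot be written as a
product of two differential operators with coefficients in `K(t)`, each of order strictly
smaller than `m`.  (`Q j` stands for `Q_{j+1}`.) -/
theorem stmt10 (K : Type*) [Field K] [CharZero K]
    (m : ℕ) (hm : 2 ≤ m)
    (T : Polynomial K) (Q : Fin m → Polynomial K)
    (hcond :
      (T ≠ 0 ∧ (Q ⟨m - 1, by omega⟩).degree = T.degree + 1 ∧
        ∀ j : Fin m, (j : ℕ) + 1 < m → (Q j).degree < T.degree + 1) ∨
      (Q ⟨m - 1, by omega⟩ ≠ 0 ∧ T.degree = (Q ⟨m - 1, by omega⟩).degree + 1 ∧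
        ∀ j : Fin m, (Q j).degree ≤ (Q ⟨m - 1, by omega⟩).degree)) :
    ¬ ∃ b c : Fin m → RatFunc K,
      polyMulOp K T * derivOp K ^ m
          - ∑ j : Fin m, polyMulOp K (Q j) * derivOp K ^ (m - 1 - (j : ℕ)) =
        (∑ i : Fin m, mulOp K (b i) * derivOp K ^ (i : ℕ)) *
        (∑ i : Fin m, mulOp K (c i) * derivOp K ^ (i : ℕ)) := by
  rintro ⟨b, c, heq⟩
  rcases hcond with ⟨hT, hQ, hle⟩ | ⟨hQ, hT, hle⟩
  · rw [Polynomial.degree_eq_natDegree hT] at hQ hle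
    have hQ0 : Q ⟨m - 1, by omega⟩ ≠ 0 := by
      intro h; rw [h, Polynomial.degree_zero] at hQ; exact absurd hQ.symm (by exact_mod_cast WithBot.coe_ne_bot)
    have hQn : (Q ⟨m - 1, by omega⟩).natDegree = T.natDegree + 1 :=
      Polynomial.natDegree_eq_of_degree_eq_some (by rw [hQ]; push_cast; rfl)
    refine Aux.setup m hm 1 (by omega) (Or.inl rfl) T Q (m * T.natDegree + m) hT hQ0 (by ring)
      (by rw [hQn]; push_cast; ring) ?_ b c heq
    intro j
    by_cases hj : (j : ℕ) + 1 < m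
    · by_cases h0 : Q j = 0
      · exact Or.inl h0
      right
      have h := hle j hj
      rw [Polynomial.degree_eq_natDegree h0] at h
      have h' : (Q j).natDegree < T.natDegree + 1 := by exact_mod_cast h
      have h2 : ((Q j).natDegree : ℤ) ≤ T.natDegree := by omega
      have := mul_le_mul_of_nonneg_left h2 (by positivity : (0:ℤ) ≤ m)
      have h3 : ((m - 1 - (j : ℕ) : ℕ) : ℤ) ≤ m := by omega
      linarith
    · right
      have hj' : j = ⟨m - 1, by omega⟩ := Fin.ext (by have := j.2; simp only; omega)
      have hz : m - 1 - (j : ℕ) = 0 := by omega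
      rw [hz, hj', hQn]; push_cast; linarith
  · rw [Polynomial.degree_eq_natDegree hQ] at hT hle
    have hT0 : T ≠ 0 := by
      intro h; rw [h, Polynomial.degree_zero] at hT; exact absurd hT.symm (by exact_mod_cast WithBot.coe_ne_bot)
    have hTn : T.natDegree = (Q ⟨m - 1, by omega⟩).natDegree + 1 :=
      Polynomial.natDegree_eq_of_degree_eq_some (by rw [hT]; push_cast; rfl)
    refine Aux.setup m hm (-1) (by omega) (Or.inr rfl) T Q (m * (Q ⟨m - 1, by omega⟩).natDegree) hT0 hQ
      (by rw [hTn]; push_cast; ring) rfl ?_ b c heq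
    intro j
    right
    have h := Polynomial.natDegree_le_of_degree_le (hle j)
    have h2 : ((Q j).natDegree : ℤ) ≤ (Q ⟨m - 1, by omega⟩).natDegree := by omega
    have := mul_le_mul_of_nonneg_left h2 (by positivity : (0:ℤ) ≤ m)
    have h3 : (0 : ℤ) ≤ ((m - 1 - (j : ℕ) : ℕ) : ℤ) := by omega
    linarith
end
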